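/- arXiv:1611.09568 — 10 statements merged into one kernel-verified Lean document; each statement's English description precedes it below -/
import Mathlib

section
/- Let λ : ℝ → [0,∞) be measurable and locally integrable, let R ≥ 0 and C ≥ 0, and suppose that ∫_x^{x+R} λ(t) dt ≤ C for every x ≥ 0. Then ∫_0^∞ exp(−∫_x^{2x+R} λ(t) dt)·λ(x) dx = ∞ if and only if ∫_0^∞ exp(−∫_x^{2x} λ(t) dt)·λ(x) dx = ∞. Moreover the two integrals satisfy the sandwich exp(−C)·∫_0^∞ exp(−∫_x^{2x} λ(t) dt)·λ(x) dx ≤ ∫_0^∞ exp(−∫_x^{2x+R} λ(t) dt)·λ(x) dx ≤ ∫_0^∞ exp(−∫_x^{2x} λ(t) dt)·λ(x) dx. -/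
open MeasureTheory Real Set

theorem stmt_0 (lam : ℝ → ℝ) (hmeas : Measurable lam)
    (hloc : LocallyIntegrable lam)
    (hnonneg : ∀ t, 0 ≤ lam t)
    (R C : ℝ) (hR : 0 ≤ R) (hC : 0 ≤ C)
    (hbound : ∀ x : ℝ, 0 ≤ x → (∫ t in x..(x + R), lam t) ≤ C) :
    (ENNReal.ofReal (Real.exp (-C)) *
        ∫⁻ x in Ioi (0:ℝ), ENNReal.ofReal (Real.exp (-(∫ t in x..(2*x), lam t)) * lam x)
      ≤ ∫⁻ x in Ioi (0:ℝ), ENNReal.ofReal (Real.exp (-(∫ t in x..(2*x + R), lam t)) * lam x)) ∧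
    ((∫⁻ x in Ioi (0:ℝ), ENNReal.ofReal (Real.exp (-(∫ t in x..(2*x + R), lam t)) * lam x))
      ≤ ∫⁻ x in Ioi (0:ℝ), ENNReal.ofReal (Real.exp (-(∫ t in x..(2*x), lam t)) * lam x)) ∧
    ((∫⁻ x in Ioi (0:ℝ), ENNReal.ofReal (Real.exp (-(∫ t in x..(2*x + R), lam t)) * lam x) = ⊤) ↔
     (∫⁻ x in Ioi (0:ℝ), ENNReal.ofReal (Real.exp (-(∫ t in x..(2*x), lam t)) * lam x) = ⊤)) := by
  have hii : ∀ a b : ℝ, IntervalIntegrable lam volume a b := fun a b =>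
    (hloc.integrableOn_isCompact isCompact_uIcc).intervalIntegrable
  have hsplit : ∀ x : ℝ, (∫ t in x..(2*x + R), lam t) =
      (∫ t in x..(2*x), lam t) + ∫ t in (2*x)..(2*x + R), lam t := fun x =>
    (intervalIntegral.integral_add_adjacent_intervals (hii _ _) (hii _ _)).symm
  have h1 : ENNReal.ofReal (Real.exp (-C)) *
        ∫⁻ x in Ioi (0:ℝ), ENNReal.ofReal (Real.exp (-(∫ t in x..(2*x), lam t)) * lam x)
      ≤ ∫⁻ x in Ioi (0:ℝ), ENNReal.ofReal (Real.exp (-(∫ t in x..(2*x + R), lam t)) * lam x) := by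
    rw [← lintegral_const_mul' _ _ ENNReal.ofReal_ne_top]
    refine setLIntegral_mono' measurableSet_Ioi fun x hx => ?_
    have hx0 : (0:ℝ) < x := hx
    rw [← ENNReal.ofReal_mul (Real.exp_nonneg _), ← mul_assoc, ← Real.exp_add]
    refine ENNReal.ofReal_le_ofReal (mul_le_mul_of_nonneg_right ?_ (hnonneg x))
    refine Real.exp_le_exp.mpr ?_
    have := hbound (2*x) (by linarith)
    rw [hsplit x]
    linarith
  have h2 : (∫⁻ x in Ioi (0:ℝ),
        ENNReal.ofReal (Real.exp (-(∫ t in x..(2*x + R), lam t)) * lam x))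
      ≤ ∫⁻ x in Ioi (0:ℝ), ENNReal.ofReal (Real.exp (-(∫ t in x..(2*x), lam t)) * lam x) := by
    refine setLIntegral_mono' measurableSet_Ioi fun x hx => ?_
    refine ENNReal.ofReal_le_ofReal (mul_le_mul_of_nonneg_right ?_ (hnonneg x))
    refine Real.exp_le_exp.mpr ?_
    have : 0 ≤ ∫ t in (2*x)..(2*x + R), lam t :=
      intervalIntegral.integral_nonneg (by linarith) fun t _ => hnonneg t
    rw [hsplit x]
    linarith
  refine ⟨h1, h2, fun h => top_le_iff.mp (h ▸ h2), fun h => ?_⟩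
  rw [h, ENNReal.mul_top (ENNReal.ofReal_pos.mpr (Real.exp_pos _)).ne'] at h1
  exact top_le_iff.mp h1
end

section
/- Let f : (0,∞) → [1,∞) be measurable with log∘f locally integrable on [1,∞), and suppose f is regularly varying with index β for some β ≥ 0. Then there exist constants C > 0 and x₀ ≥ 1 such that for all x ≥ x₀, |∫_x^{2x} (log f(t))/t dt − (log 2)·log f(x)| ≤ C. -/
open MeasureTheory Real Set Filter

theorem aux_bdd (h : ℝ → ℝ) (hm : Measurable h) (c : ℝ → ℝ)
    (hl : ∀ s : ℝ, Tendsto (fun u => h (u + s) - h u) atTop (nhds (c s))) :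
    ∃ M : ℝ, 0 < M ∧ ∃ T : ℝ, 0 ≤ T ∧ ∀ u ≥ T, ∀ s ∈ Icc (0:ℝ) 1, |h (u + s) - h u| ≤ M := by
  let A : ℕ → Set ℝ := fun n => {s | s ∈ Icc (0:ℝ) 2 ∧ ∀ u ≥ (n:ℝ), |h (u + s) - h u| ≤ n}
  have hmono : Monotone A := by
    intro m n hmn s hs
    have hc : (m:ℝ) ≤ n := by exact_mod_cast hmn
    exact ⟨hs.1, fun u hu => (hs.2 u (hc.trans hu)).trans hc⟩
  have hU : (⋃ n, A n) = Icc (0:ℝ) 2 := by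
    ext s
    simp only [mem_iUnion]
    constructor
    · rintro ⟨n, hn⟩
      exact hn.1
    · intro hs
      have h2 : ∀ᶠ u in atTop, |h (u + s) - h u| < |c s| + 1 :=
        (hl s).abs.eventually_lt_const (by linarith)
      obtain ⟨T, hT⟩ := eventually_atTop.1 h2
      obtain ⟨n, hn⟩ := exists_nat_ge (max T (|c s| + 1))
      refine ⟨n, hs, fun u hu => ?_⟩
      exact (hT u (((le_max_left _ _).trans hn).trans hu)).le.trans ((le_max_right _ _).trans hn)
  have ht : Tendsto (fun n => volume (A n)) atTop (nhds (volume (Icc (0:ℝ) 2))) := by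
    rw [← hU]
    exact tendsto_measure_iUnion_atTop hmono
  have h32 : ENNReal.ofReal (3/2) < volume (Icc (0:ℝ) 2) := by
    rw [Real.volume_Icc]
    exact (ENNReal.ofReal_lt_ofReal_iff (by norm_num)).2 (by norm_num)
  obtain ⟨n, hn, hn1⟩ := ((ht.eventually_const_lt h32).and (eventually_ge_atTop 1)).exists
  have hn0 : (1:ℝ) ≤ n := by exact_mod_cast hn1
  refine ⟨2 * n, by linarith, n, by linarith, fun u hu s hs => ?_⟩
  let E : Set ℝ := {t | t ∈ Icc (0:ℝ) 2 ∧ |h (u + t) - h u| ≤ n}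
  let F : Set ℝ := (fun t => t + -s) ⁻¹' (A n)
  have hE : MeasurableSet E := by
    have h3 := hm.comp (measurable_const_add u)
    have h4 : Measurable (fun t => |h (u + t) - h u|) :=
      continuous_abs.measurable.comp (h3.sub_const _)
    have h5 : MeasurableSet {t | |h (u + t) - h u| ≤ n} := measurableSet_le h4 measurable_const
    exact measurableSet_Icc.inter h5
  have hEv : ENNReal.ofReal (3/2) < volume E :=
    hn.trans_le (measure_mono fun t ht => ⟨ht.1, ht.2 u hu⟩)
  have hFv : ENNReal.ofReal (3/2) < volume F := by
    rw [show volume F = volume (A n) from measure_preimage_add_right volume (-s) (A n)]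
    exact hn
  have hFE : (F ∩ E).Nonempty := by
    refine nonempty_inter_of_measure_lt_add volume hE (u := Icc (0:ℝ) 3) ?_ ?_ ?_
    · intro t ht
      have h3 := ht.1
      simp only [mem_Icc] at h3 hs ⊢
      constructor <;> linarith
    · intro t ht
      exact ⟨ht.1.1, ht.1.2.trans (by norm_num)⟩
    · refine lt_of_eq_of_lt ?_ (ENNReal.add_lt_add hFv hEv)
      rw [Real.volume_Icc, ← ENNReal.ofReal_add (by norm_num) (by norm_num)]
      norm_num
  obtain ⟨t, htF, htE⟩ := hFE
  have e1 := htF.2 (u + s) (by linarith [hs.1])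
  have e2 := htE.2
  rw [show u + s + (t + -s) = u + t by ring] at e1
  rw [abs_le] at *
  constructor <;> linarith [e1.1, e1.2, e2.1, e2.2]

theorem stmt_1 (f : ℝ → ℝ) (β : ℝ) (hβ : 0 ≤ β)
    (hmeas : Measurable f)
    (h1 : ∀ x : ℝ, 0 < x → 1 ≤ f x)
    (hloc : LocallyIntegrableOn (fun t => Real.log (f t)) (Set.Ici 1))
    (hreg : ∀ a : ℝ, 0 < a →
      Tendsto (fun x => f (a * x) / f x) atTop (nhds (a ^ β))) :
    ∃ C > (0:ℝ), ∃ x₀ ≥ (1:ℝ), ∀ x ≥ x₀,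
      |(∫ t in x..(2*x), Real.log (f t) / t) - Real.log 2 * Real.log (f x)| ≤ C := by
  obtain ⟨M, hM, T, hT, hb⟩ := aux_bdd (fun u => Real.log (f (Real.exp u)))
    (Real.measurable_log.comp (hmeas.comp Real.measurable_exp))
    (fun s => Real.log (Real.exp s ^ β)) (by
      intro s
      have h2 := ((hreg (Real.exp s) (Real.exp_pos s)).comp Real.tendsto_exp_atTop).log
        (Real.rpow_pos_of_pos (Real.exp_pos s) β).ne'
      refine h2.congr fun u => ?_
      have p1 := h1 (Real.exp u) (Real.exp_pos u)
      have p2 := h1 (Real.exp s * Real.exp u) (by positivity)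
      simp only [Function.comp]
      rw [Real.log_div (by linarith) (by linarith), add_comm u s, Real.exp_add])
  refine ⟨M, hM, Real.exp T, Real.one_le_exp hT, fun x hx => ?_⟩
  have hx1 : 1 ≤ x := (Real.one_le_exp hT).trans hx
  have hx0 : 0 < x := by linarith
  have hle : x ≤ 2 * x := by linarith
  have hpt : ∀ t ∈ Icc x (2*x), |Real.log (f t) - Real.log (f x)| ≤ M := by
    intro t ht
    have ht0 : 0 < t := hx0.trans_le ht.1
    have := hb (Real.log x) ((Real.le_log_iff_exp_le hx0).2 hx) (Real.log t - Real.log x) (by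
      constructor
      · linarith [Real.log_le_log hx0 ht.1]
      · have := Real.log_le_log ht0 ht.2
        rw [Real.log_mul (by norm_num) hx0.ne'] at this
        linarith [Real.log_two_lt_d9])
    simpa [Real.exp_log hx0, Real.exp_log ht0] using this
  have hcont : ContinuousOn (fun t : ℝ => t⁻¹) (uIcc x (2*x)) := by
    rw [uIcc_of_le hle]
    exact continuousOn_inv₀.mono fun t ht => (hx0.trans_le ht.1).ne'
  have hi1 : IntervalIntegrable (fun t => Real.log (f t)) volume x (2*x) := by
    rw [intervalIntegrable_iff_integrableOn_Icc_of_le hle]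
    exact hloc.integrableOn_compact_subset (fun t ht => hx1.trans ht.1) isCompact_Icc
  have hi2 : IntervalIntegrable (fun t => Real.log (f t) / t) volume x (2*x) := by
    simpa only [div_eq_mul_inv] using hi1.mul_continuousOn hcont
  have hi3 : IntervalIntegrable (fun t => Real.log (f x) * t⁻¹) volume x (2*x) :=
    (hcont.intervalIntegrable).const_mul _
  have hc : Real.log 2 * Real.log (f x) = ∫ t in x..(2*x), Real.log (f x) * t⁻¹ := by
    rw [intervalIntegral.integral_const_mul, integral_inv_of_pos hx0 (by linarith),
      mul_div_cancel_right₀ _ hx0.ne', mul_comm]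
  rw [hc, ← intervalIntegral.integral_sub hi2 hi3]
  have := intervalIntegral.norm_integral_le_of_norm_le_const (a := x) (b := 2*x) (C := M / x)
    (f := fun t => Real.log (f t) / t - Real.log (f x) * t⁻¹) (by
      intro t ht
      rw [uIoc_of_le hle] at ht
      have ht0 : 0 < t := hx0.trans ht.1
      rw [show Real.log (f t) / t - Real.log (f x) * t⁻¹
        = (Real.log (f t) - Real.log (f x)) / t by ring, Real.norm_eq_abs, abs_div, abs_of_pos ht0]
      exact div_le_div₀ hM.le (hpt t ⟨ht.1.le, ht.2⟩) hx0 ht.1.le)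
  rw [Real.norm_eq_abs] at this
  refine this.trans (le_of_eq ?_)
  rw [show 2 * x - x = x by ring, abs_of_pos hx0]
  field_simp
end

section
/- Let f : (0,∞) → [1,∞) be measurable with log∘f locally integrable on [1,∞), and suppose f is regularly varying with index β for some β ≥ 0. Define λ_f(x) = (log f(x))/(x·log 2) for x ≥ 1. Then ∫_1^∞ exp(−∫_x^{2x} λ_f(t) dt)·λ_f(x) dx = ∞ if and only if ∫_1^∞ (log f(x))/(x·f(x)) dx = ∞. -/
open MeasureTheory Real Set Filter

lemma aux_unif (h : ℝ → ℝ) (β : ℝ) (hm : Measurable h)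
    (hr : ∀ s : ℝ, Tendsto (fun y => h (y + s) - h y) atTop (nhds (β * s))) :
    ∃ C Y : ℝ, ∀ y, Y ≤ y → ∀ u ∈ Icc (0:ℝ) 1, |h (y + u) - h y| ≤ C := by
  set K : ℝ := |β| * 4 + 1 with hK
  let E : ℝ → Set ℝ := fun y => Icc (0:ℝ) 4 ∩ {s | K < |h (y + s) - h y|}
  have hE : ∀ y, MeasurableSet (E y) := by
    intro y
    refine measurableSet_Icc.inter (measurableSet_lt measurable_const ?_)
    exact ((hm.comp (measurable_const.add measurable_id)).sub measurable_const).abs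
  have ht : Tendsto (fun y => volume (E y)) atTop (nhds (volume (∅ : Set ℝ))) := by
    refine tendsto_measure_of_tendsto_indicator (B := Icc (0:ℝ) 4) atTop hE measurableSet_Icc
      (by simp) (Eventually.of_forall fun y => inter_subset_left) ?_
    intro s
    by_cases hs : s ∈ Icc (0:ℝ) 4
    · have h2 : |β * s| < K := by
        rw [abs_mul, abs_of_nonneg hs.1]
        nlinarith [abs_nonneg β, hs.2, mul_le_mul_of_nonneg_left hs.2 (abs_nonneg β)]
      filter_upwards [(hr s).abs.eventually_lt_const h2] with y hy
      simp only [E, mem_inter_iff, mem_ofPred_eq, mem_empty_iff_false, iff_false, not_and, not_lt]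
      exact fun _ => hy.le
    · exact Eventually.of_forall fun y => by simp [E, hs]
  rw [measure_empty] at ht
  obtain ⟨Y, hY⟩ := eventually_atTop.1 (ht.eventually_lt_const (zero_lt_one))
  refine ⟨2 * K, Y, fun y hy u hu => ?_⟩
  by_contra! hc
  have hsub : Icc (1:ℝ) 4 ⊆ E y ∪ (fun s => s + (-u)) ⁻¹' E (y + u) := by
    intro s hs
    by_contra hn
    simp only [E, mem_union, mem_inter_iff, mem_preimage, mem_ofPred_eq, mem_Icc, not_or,
      not_and, not_lt] at hn
    have a1 := hn.1 ⟨by linarith [hs.1], hs.2⟩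
    have a2 := hn.2 ⟨by linarith [hs.1, hu.2], by linarith [hs.2, hu.1]⟩
    rw [show y + u + (s + -u) = y + s by ring] at a2
    have a3 := abs_sub_le (h (y+u)) (h (y+s)) (h y)
    rw [abs_sub_comm (h (y+u)) (h (y+s))] at a3
    linarith
  have hv := (measure_mono hsub).trans (measure_union_le (μ := volume) _ _)
  rw [measure_preimage_add_right, Real.volume_Icc] at hv
  have := hv.trans (add_le_add (hY y hy).le (hY (y+u) (by linarith [hu.1])).le)
  rw [show (1:ENNReal) + 1 = ENNReal.ofReal 2 by norm_num, 
    ENNReal.ofReal_le_ofReal_iff (by norm_num)] at this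
  norm_num at this

lemma aux_cmp (A B : ℝ → ENNReal) (X : ℝ) (hX : 1 ≤ X) (c : ENNReal) (hc : c ≠ ⊤)
    (hA : ∫⁻ x in Ioc 1 X, A x ≠ ⊤) (hAB : ∀ x, X < x → A x ≤ c * B x)
    (h : ∫⁻ x in Ioi 1, A x = ⊤) : ∫⁻ x in Ioi 1, B x = ⊤ := by
  by_contra hB
  have h1 : ∫⁻ x in Ioi X, A x ≤ c * ∫⁻ x in Ioi 1, B x := by
    calc _ ≤ ∫⁻ x in Ioi X, c * B x := setLIntegral_mono' measurableSet_Ioi (fun x hx => hAB x hx)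
      _ = c * ∫⁻ x in Ioi X, B x := lintegral_const_mul' _ _ hc
      _ ≤ _ := by gcongr
  have h2 : ∫⁻ x in Ioi 1, A x ≤ (∫⁻ x in Ioc 1 X, A x) + ∫⁻ x in Ioi X, A x := by
    rw [← Ioc_union_Ioi_eq_Ioi hX]
    exact lintegral_union_le _ _ _
  rw [h, top_le_iff, ENNReal.add_eq_top] at h2
  rcases h2 with h2 | h2
  · exact hA h2
  · rw [h2, top_le_iff] at h1
    exact ENNReal.mul_ne_top hc hB h1

lemma aux_int (F : ℝ → ℝ) (hm : Measurable F) (x C : ℝ) (hx : 1 ≤ x)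
    (hC : ∀ t ∈ Icc x (2*x), |F t - F x| ≤ C) :
    |(∫ t in x..(2*x), F t / (t * Real.log 2)) - F x| ≤ C := by
  have l2 : 0 < Real.log 2 := Real.log_pos (by norm_num)
  have hle : x ≤ 2 * x := by linarith
  have hconst : ∀ d : ℝ, ∫ t in x..(2*x), d / (t * Real.log 2) = d := by
    intro d
    have : ∀ t : ℝ, d / (t * Real.log 2) = (d / Real.log 2) * t⁻¹ := by
      intro t; rw [div_mul_eq_div_div_swap, div_eq_mul_inv]
    simp_rw [this]
    rw [intervalIntegral.integral_const_mul, integral_inv_of_pos (by linarith) (by linarith),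
      mul_div_cancel_right₀ _ (by linarith : x ≠ 0)]
    field_simp
  have hci : ∀ d : ℝ, IntervalIntegrable (fun t => d / (t * Real.log 2)) volume x (2*x) := by
    intro d
    apply ContinuousOn.intervalIntegrable
    rw [uIcc_of_le hle]
    refine continuousOn_const.div (continuousOn_id.mul continuousOn_const) ?_
    intro t ht
    have : 0 < t := by linarith [ht.1]
    positivity
  have hFi : IntervalIntegrable (fun t => F t / (t * Real.log 2)) volume x (2*x) := by
    refine (hci (|F x| + C)).mono_fun
      (hm.div (measurable_id.mul_const _)).aestronglyMeasurable ?_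
    rw [uIoc_of_le hle]
    refine (ae_restrict_iff' measurableSet_Ioc).2 (Eventually.of_forall fun t ht => ?_)
    have h0 := hC t ⟨ht.1.le, ht.2⟩
    simp only [norm_div, Real.norm_eq_abs]
    refine div_le_div_of_nonneg_right ?_ (abs_nonneg _)
    refine le_trans ?_ (le_abs_self _)
    linarith [abs_sub_abs_le_abs_sub (F t) (F x)]
  have up := intervalIntegral.integral_mono_on hle hFi (hci (F x + C)) (fun t ht => by
    have : 0 < t := by linarith [ht.1]
    have := (abs_le.1 (hC t ht)).2
    gcongr; linarith)
  have lo := intervalIntegral.integral_mono_on hle (hci (F x - C)) hFi (fun t ht => by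
    have : 0 < t := by linarith [ht.1]
    have := (abs_le.1 (hC t ht)).1
    gcongr; linarith)
  rw [hconst] at up lo
  exact abs_le.2 ⟨by linarith, by linarith⟩

theorem stmt_2 (f : ℝ → ℝ) (β : ℝ) (hβ : 0 ≤ β)
    (hmeas : Measurable f)
    (h1 : ∀ x : ℝ, 0 < x → 1 ≤ f x)
    (hloc : LocallyIntegrableOn (fun t => Real.log (f t)) (Set.Ici 1))
    (hreg : ∀ a : ℝ, 0 < a →
      Tendsto (fun x => f (a * x) / f x) atTop (nhds (a ^ β))) :
    (∫⁻ x in Ioi (1:ℝ),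
        ENNReal.ofReal (Real.exp (-(∫ t in x..(2*x), Real.log (f t) / (t * Real.log 2))) *
          (Real.log (f x) / (x * Real.log 2))) = ⊤) ↔
    (∫⁻ x in Ioi (1:ℝ), ENNReal.ofReal (Real.log (f x) / (x * f x)) = ⊤) := by
  have l2 : 0 < Real.log 2 := Real.log_pos (by norm_num)
  have hlm : Measurable (fun t => Real.log (f t)) := Real.measurable_log.comp hmeas
  have hpos : ∀ x, 0 < x → 0 < f x := fun x hx => by linarith [h1 x hx]
  have hF0 : ∀ x, 0 < x → 0 ≤ Real.log (f x) := fun x hx => Real.log_nonneg (h1 x hx)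
  obtain ⟨C, Y, hCY⟩ := aux_unif (fun y => Real.log (f (Real.exp y))) β
    (hlm.comp Real.measurable_exp) (by
      intro s
      have h := ((hreg (Real.exp s) (Real.exp_pos s)).log
        (by positivity)).comp Real.tendsto_exp_atTop
      rw [Real.log_rpow (Real.exp_pos s), Real.log_exp] at h
      refine h.congr fun y => ?_
      simp only [Function.comp]
      rw [Real.log_div (hpos _ (by positivity)).ne' (hpos _ (by positivity)).ne', Real.exp_add,
        mul_comm])
  set X := max 1 (Real.exp Y) with hXdef
  have hX1 : 1 ≤ X := le_max_left _ _
  have key : ∀ x, X < x →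
      |(∫ t in x..(2*x), Real.log (f t) / (t * Real.log 2)) - Real.log (f x)| ≤ C := by
    intro x hx
    have hx1 : 1 < x := lt_of_le_of_lt hX1 hx
    have hx0 : 0 < x := by linarith
    refine aux_int (fun t => Real.log (f t)) hlm x C hx1.le (fun t ht => ?_)
    have ht0 : 0 < t := by linarith [ht.1]
    have := hCY (Real.log x) ((Real.le_log_iff_exp_le hx0).2
      ((le_max_right _ _).trans hx.le)) (Real.log t - Real.log x) ⟨by
        linarith [Real.log_le_log hx0 ht.1], by
        have := Real.log_le_log ht0 ht.2
        rw [Real.log_mul (by norm_num) hx0.ne'] at this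
        linarith [Real.log_two_lt_d9]⟩
    simpa [Real.exp_log ht0, Real.exp_log hx0] using this
  have hfin : ∀ d : ℝ, ∫⁻ x in Ioc 1 X, ENNReal.ofReal (Real.log (f x) * d) ≠ ⊤ := by
    intro d
    have hi : IntegrableOn (fun t => Real.log (f t)) (Icc 1 X) :=
      hloc.integrableOn_compact_subset Icc_subset_Ici_self isCompact_Icc
    exact ((hi.mono_set Ioc_subset_Icc_self).mul_const d).lintegral_lt_top.ne
  constructor
  · refine aux_cmp _ _ X hX1 (ENNReal.ofReal (Real.exp C / Real.log 2)) ENNReal.ofReal_ne_top ?_ ?_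
    · refine ne_top_of_le_ne_top (hfin (Real.log 2)⁻¹) 
        (setLIntegral_mono' measurableSet_Ioc fun x hx => ENNReal.ofReal_le_ofReal ?_)
      have hx0 : 0 < x := by linarith [hx.1]
      have hI : 0 ≤ ∫ t in x..(2*x), Real.log (f t) / (t * Real.log 2) :=
        intervalIntegral.integral_nonneg (by linarith) fun t ht => by
          have ht0 : 0 < t := by linarith [ht.1]
          have := hF0 t ht0
          positivity
      have hF := hF0 x hx0
      calc _ ≤ 1 * (Real.log (f x) / (1 * Real.log 2)) := by
            gcongr
            · exact Real.exp_le_one_iff.2 (by linarith)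
            · exact hx.1.le
        _ = _ := by rw [one_mul, one_mul, div_eq_mul_inv]
    · intro x hx
      have hx0 : 0 < x := by linarith
      rw [← ENNReal.ofReal_mul (by positivity)]
      apply ENNReal.ofReal_le_ofReal
      have hF := hF0 x hx0
      have hf := hpos x hx0
      have k := (abs_le.1 (key x hx)).1
      calc _ ≤ Real.exp (C - Real.log (f x)) * (Real.log (f x) / (x * Real.log 2)) := by
            gcongr; linarith
        _ = _ := by
            rw [Real.exp_sub, Real.exp_log hf]; field_simp
  · refine aux_cmp _ _ X hX1 (ENNReal.ofReal (Real.exp C * Real.log 2)) ENNReal.ofReal_ne_top ?_ ?_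
    · refine ne_top_of_le_ne_top (hfin 1) 
        (setLIntegral_mono' measurableSet_Ioc fun x hx => ENNReal.ofReal_le_ofReal ?_)
      have hx0 : 0 < x := by linarith [hx.1]
      rw [mul_one]
      refine div_le_self (hF0 x hx0) ?_
      nlinarith [h1 x hx0, hx.1]
    · intro x hx
      have hx0 : 0 < x := by linarith
      rw [← ENNReal.ofReal_mul (by positivity)]
      apply ENNReal.ofReal_le_ofReal
      have hF := hF0 x hx0
      have hf := hpos x hx0
      have k := (abs_le.1 (key x hx)).2
      calc _ = Real.exp C * Real.log 2 * (Real.exp (-C - Real.log (f x)) *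
              (Real.log (f x) / (x * Real.log 2))) := by
            rw [Real.exp_sub, Real.exp_log hf, Real.exp_neg]; field_simp
        _ ≤ _ := by
            gcongr; linarith
end

section
/- Let β > 0 and let f : (0,∞) → [1,∞) be measurable, regularly varying with index β, and such that log∘f is locally integrable on [1,∞). Then ∫_1^∞ (log f(x))/(x·f(x)) dx < ∞. -/
open MeasureTheory Real Set Filter

theorem stmt_4 (β : ℝ) (hβ : 0 < β) (f : ℝ → ℝ) (hmeas : Measurable f)
    (h1 : ∀ x : ℝ, 0 < x → 1 ≤ f x)
    (hloc : LocallyIntegrableOn (fun t => Real.log (f t)) (Set.Ici 1))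
    (hreg : ∀ a : ℝ, 0 < a →
      Tendsto (fun x => f (a * x) / f x) atTop (nhds (a ^ β))) :
    IntegrableOn (fun x => Real.log (f x) / (x * f x)) (Set.Ioi 1) := by
  have hlt : (2:ℝ) ^ (β / 2) < 2 ^ β :=
    Real.rpow_lt_rpow_of_exponent_lt (by norm_num) (by linarith)
  obtain ⟨X0, hX0⟩ := eventually_atTop.1 ((hreg 2 (by norm_num)).eventually (lt_mem_nhds hlt))
  obtain ⟨X, hX, hXpos⟩ : ∃ X, X0 ≤ X ∧ 0 < X :=
    ⟨max X0 1, le_max_left _ _, lt_of_lt_of_le one_pos (le_max_right _ _)⟩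
  have key : ∀ n : ℕ, ∀ x : ℝ, 0 < x → x ≤ 2 ^ n * (2 * X) → (x / (2 * X)) ^ (β / 2) ≤ f x := by
    have base : ∀ x : ℝ, 0 < x → x ≤ 2 * X → (x / (2 * X)) ^ (β / 2) ≤ f x := by
      intro x hx hx2
      refine le_trans (Real.rpow_le_one (by positivity) ?_ (by positivity)) (h1 x hx)
      rw [div_le_one (by positivity)]
      exact hx2
    intro n
    induction n with
    | zero => intro x hx hx2; exact base x hx (by simpa using hx2)
    | succ n ih =>
      intro x hx hx2
      rcases le_total x (2 * X) with h | h
      · exact base x hx h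
      have hi := ih (x / 2) (by positivity) (by rw [pow_succ] at hx2; linarith)
      have hq := hX0 (x / 2) (by linarith)
      have hp : 0 < f (x / 2) := lt_of_lt_of_le one_pos (h1 _ (by positivity))
      rw [lt_div_iff₀ hp, show 2 * (x / 2) = x by ring] at hq
      calc (x / (2 * X)) ^ (β / 2) = (2 * (x / 2 / (2 * X))) ^ (β / 2) := by
            congr 1; ring
        _ = 2 ^ (β / 2) * (x / 2 / (2 * X)) ^ (β / 2) :=
            Real.mul_rpow (by norm_num) (by positivity)
        _ ≤ 2 ^ (β / 2) * f (x / 2) := by gcongr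
        _ ≤ f x := hq.le
  have key2 : ∀ x : ℝ, 0 < x → (x / (2 * X)) ^ (β / 2) ≤ f x := by
    intro x hx
    obtain ⟨n, hn⟩ := pow_unbounded_of_one_lt (x / (2 * X)) (one_lt_two (α := ℝ))
    exact key n x hx ((div_lt_iff₀ (by positivity)).1 hn).le
  have hint : IntegrableOn (fun x : ℝ => (2 * (2 * X) ^ (β / 4)) * x ^ (-1 - β / 4)) (Ioi 1) :=
    (integrableOn_Ioi_rpow_of_lt (by linarith) one_pos).const_mul _
  refine Integrable.mono' hint ?_ ?_
  · exact Measurable.aestronglyMeasurable (by fun_prop)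
  · refine (ae_restrict_iff' measurableSet_Ioi).2 (Eventually.of_forall fun x hx => ?_)
    have hx0 : (0:ℝ) < x := lt_trans one_pos hx
    have hf := h1 x hx0
    have hf0 : 0 < f x := by linarith
    rw [Real.norm_of_nonneg (div_nonneg (Real.log_nonneg hf) (by positivity))]
    have hl : Real.log (f x) ≤ f x ^ (1/2 : ℝ) / (1/2) := Real.log_le_rpow_div hf0.le (by norm_num)
    have hk : (x / (2 * X)) ^ (β / 4) ≤ f x ^ (1/2 : ℝ) := by
      have := Real.rpow_le_rpow (by positivity) (key2 x hx0) (show (0:ℝ) ≤ 1/2 by norm_num)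
      rwa [← Real.rpow_mul (by positivity), show β / 2 * (1 / 2) = β / 4 by ring] at this
    have hs : f x = f x ^ (1/2 : ℝ) * f x ^ (1/2 : ℝ) := by
      rw [← Real.rpow_add hf0]; norm_num
    rw [Real.div_rpow hx0.le (by positivity), div_le_iff₀ (by positivity)] at hk
    rw [Real.rpow_sub hx0, Real.rpow_neg_one]
    set s := f x ^ (1/2 : ℝ)
    have hs0 : 0 < s := by positivity
    have hb : 0 < x ^ (β / 4) := by positivity
    calc Real.log (f x) / (x * f x) ≤ (s / (1/2)) / (x * f x) := by gcongr
      _ = 2 / (x * s) := by rw [hs]; field_simp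
      _ ≤ 2 * (2 * X) ^ (β / 4) * (x⁻¹ / x ^ (β / 4)) := by
        rw [div_le_iff₀ (by positivity)]
        have : 2 * (2 * X) ^ (β / 4) * (x⁻¹ / x ^ (β / 4)) * (x * s)
          = 2 * (s * (2 * X) ^ (β / 4) / x ^ (β / 4)) := by field_simp
        rw [this]
        have := (one_le_div hb).2 hk
        linarith
end

section
/- Let β > 0 and let f : (0,∞) → [1,∞) be measurable, regularly varying with index β, and such that log∘f is locally integrable on [1,∞). Define λ_f(x) = (log f(x))/(x·log 2) for x ≥ 1. Then ∫_1^∞ exp(−∫_x^{2x} λ_f(t) dt)·λ_f(x) dx < ∞. -/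
open MeasureTheory Real Set Filter

lemma key_aux (g : ℝ → ℝ) (hg : ∀ a b, IntervalIntegrable g volume a b) (h0 : ∀ x, 0 ≤ g x)
    (X k : ℝ) (hX1 : 1 ≤ X) (hk : 0 < k) (hX : ∀ t, X ≤ t → g t + k * t⁻¹ ≤ 2 * g (2 * t)) :
    IntegrableOn (fun x => Real.exp (-(∫ t in x..(2*x), g t)) * g x) (Set.Ioi 1) := by
  set A : ℝ → ℝ := fun x => ∫ t in x..(2*x), g t with hA
  have hAc : Continuous A := by
    have hP : Continuous (fun x => ∫ t in (0:ℝ)..x, g t) :=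
      intervalIntegral.continuous_primitive hg 0
    have : A = fun x => (∫ t in (0:ℝ)..(2*x), g t) - ∫ t in (0:ℝ)..x, g t := by
      funext x
      exact (intervalIntegral.integral_interval_sub_left (hg _ _) (hg _ _)).symm
    rw [this]
    exact (hP.comp (continuous_const.mul continuous_id)).sub hP
  have hA0 : ∀ x, 0 ≤ x → 0 ≤ A x := fun x hx =>
    intervalIntegral.integral_nonneg (by linarith) (fun t _ => h0 t)
  have hF : ∀ a b, IntervalIntegrable (fun x => Real.exp (-(A x)) * g x) volume a b := by
    intro a b
    exact (hg a b).continuousOn_mul (by fun_prop)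
  -- growth of A
  have hgrow : ∀ x y, X ≤ x → x ≤ y → A x + k * Real.log (y / x) ≤ A y := by
    intro x y hx hxy
    have hxp : 0 < x := by linarith
    have e1 : A y - A x = (∫ t in (2*x)..(2*y), g t) - ∫ t in x..y, g t := by
      have i1 := intervalIntegral.integral_add_adjacent_intervals (hg x y) (hg y (2*y))
      have i2 := intervalIntegral.integral_add_adjacent_intervals (hg x (2*x)) (hg (2*x) (2*y))
      simp only [hA]
      linarith
    have e2 : (∫ t in (2*x)..(2*y), g t) = ∫ t in x..y, 2 * g (2 * t) := by
      rw [intervalIntegral.integral_const_mul]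
      have := intervalIntegral.mul_integral_comp_mul_left (f := g) (a := x) (b := y) 2
      simpa using this.symm
    have hi : IntervalIntegrable (fun t => 2 * g (2 * t)) volume x y := by
      have := (hg (2*x) (2*y)).comp_mul_left (c := 2)
      have h2 := this.const_mul 2
      simpa using h2
    have hinv : IntervalIntegrable (fun t : ℝ => k * t⁻¹) volume x y := by
      apply ContinuousOn.intervalIntegrable
      rw [uIcc_of_le hxy]
      apply ContinuousOn.mul continuousOn_const
      apply ContinuousOn.inv₀ continuousOn_id
      intro t ht
      have := ht.1
      simp only [id]
      linarith
    have e3 : (∫ t in x..y, (g t + k * t⁻¹)) ≤ ∫ t in x..y, 2 * g (2 * t) :=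
      intervalIntegral.integral_mono_on hxy ((hg x y).add hinv) hi
        (fun t ht => hX t (by linarith [ht.1]))
    rw [intervalIntegral.integral_add (hg x y) hinv, intervalIntegral.integral_const_mul,
      integral_inv_of_pos hxp (by linarith)] at e3
    linarith
  have hmono : ∀ x y, X ≤ x → x ≤ y → A x ≤ A y := by
    intro x y hx hxy
    have h := hgrow x y hx hxy
    have hxp : 0 < x := by linarith
    have : 0 ≤ Real.log (y / x) := Real.log_nonneg (by rwa [le_div_iff₀ hxp, one_mul])
    nlinarith
  set b : ℕ → ℝ := fun n => 2 ^ n * X with hb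
  have hbX : ∀ n, X ≤ b n := by
    intro n
    have : (1:ℝ) ≤ 2 ^ n := one_le_pow₀ (by norm_num)
    simp only [hb]
    nlinarith
  have hbs : ∀ n, b (n+1) = 2 * b n := by
    intro n
    simp only [hb]
    ring
  have hblock : ∀ n : ℕ, (∫ x in (b n)..(b (n+1)), Real.exp (-(A x)) * g x)
      ≤ 2 * (Real.exp (-(k * Real.log 2 / 2))) ^ n := by
    intro n
    have hle : b n ≤ b (n+1) := by rw [hbs]; linarith [hbX n]
    have s1 : (∫ x in (b n)..(b (n+1)), Real.exp (-(A x)) * g x)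
        ≤ ∫ x in (b n)..(b (n+1)), Real.exp (-(A (b n))) * g x := by
      apply intervalIntegral.integral_mono_on hle (hF _ _) ((hg _ _).const_mul _)
      intro x hx
      apply mul_le_mul_of_nonneg_right _ (h0 x)
      apply Real.exp_le_exp.mpr
      linarith [hmono (b n) x (hbX n) hx.1]
    have s2 : (∫ x in (b n)..(b (n+1)), Real.exp (-(A (b n))) * g x)
        = Real.exp (-(A (b n))) * A (b n) := by
      rw [intervalIntegral.integral_const_mul, hbs]
    have s3 : (n:ℝ) * (k * Real.log 2) ≤ A (b n) := by
      have h := hgrow X (b n) le_rfl (hbX n)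
      have h' := hA0 X (by linarith)
      have : b n / X = 2 ^ n := by
        simp only [hb]
        field_simp
      rw [this, Real.log_pow] at h
      nlinarith
    have s4 : Real.exp (-(A (b n))) * A (b n) ≤ 2 * Real.exp (-(A (b n) / 2)) := by
      have e : Real.exp (-(A (b n))) = Real.exp (-(A (b n)/2)) * Real.exp (-(A (b n)/2)) := by
        rw [← Real.exp_add]; ring_nf
      have q : Real.exp (-(A (b n)/2)) * (A (b n)) ≤ 2 := by
        have h := Real.add_one_le_exp (A (b n) / 2)
        rw [Real.exp_neg, inv_mul_le_iff₀ (Real.exp_pos _)]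
        linarith
      rw [e, mul_assoc, mul_comm 2]
      exact mul_le_mul_of_nonneg_left q (Real.exp_pos _).le
    have s5 : Real.exp (-(A (b n) / 2)) ≤ (Real.exp (-(k * Real.log 2 / 2))) ^ n := by
      rw [← Real.exp_nat_mul]
      apply Real.exp_le_exp.mpr
      linarith
    linarith
  set r := Real.exp (-(k * Real.log 2 / 2)) with hr
  have hr1 : r < 1 := by
    rw [hr, Real.exp_lt_one_iff]
    have : 0 < k * Real.log 2 := mul_pos hk (Real.log_pos (by norm_num))
    linarith
  have hr0 : 0 ≤ r := (Real.exp_pos _).le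
  have htail : IntegrableOn (fun x => Real.exp (-(A x)) * g x) (Ioi X) := by
    apply integrableOn_Ioi_of_intervalIntegral_norm_bounded (l := atTop) (b := b)
      (2 * (1 - r)⁻¹) X
    · intro n
      exact (hF X (b n)).1
    · exact (tendsto_pow_atTop_atTop_of_one_lt (by norm_num : (1:ℝ) < 2)).atTop_mul_const
        (by linarith)
    · refine Eventually.of_forall fun n => ?_
      have e0 : ∀ x, ‖Real.exp (-(A x)) * g x‖ = Real.exp (-(A x)) * g x := fun x =>
        Real.norm_of_nonneg (mul_nonneg (Real.exp_pos _).le (h0 x))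
      simp_rw [e0]
      have hb0 : b 0 = X := by simp [hb]
      have hs := intervalIntegral.sum_integral_adjacent_intervals (a := b) (n := n)
        (fun m _ => hF (b m) (b (m+1)))
      rw [hb0] at hs
      rw [← hs]
      calc _ ≤ ∑ i ∈ Finset.range n, 2 * r ^ i := Finset.sum_le_sum fun i _ => hblock i
        _ = 2 * ∑ i ∈ Finset.range n, r ^ i := by rw [Finset.mul_sum]
        _ ≤ 2 * (1 - r)⁻¹ := by
          have := (summable_geometric_of_lt_one hr0 hr1).sum_le_tsum (Finset.range n)
            (fun i _ => pow_nonneg hr0 i)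
          rw [tsum_geometric_of_lt_one hr0 hr1] at this
          linarith
  have : Ioi (1:ℝ) = Ioc 1 X ∪ Ioi X := (Ioc_union_Ioi_eq_Ioi hX1).symm
  rw [this]
  exact ((hF 1 X).1).union htail

theorem stmt_5 (β : ℝ) (hβ : 0 < β) (f : ℝ → ℝ) (hmeas : Measurable f)
    (h1 : ∀ x : ℝ, 0 < x → 1 ≤ f x)
    (hloc : LocallyIntegrableOn (fun t => Real.log (f t)) (Set.Ici 1))
    (hreg : ∀ a : ℝ, 0 < a →
      Tendsto (fun x => f (a * x) / f x) atTop (nhds (a ^ β))) :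
    IntegrableOn (fun x =>
        Real.exp (-(∫ t in x..(2*x), Real.log (f t) / (t * Real.log 2))) *
          (Real.log (f x) / (x * Real.log 2)))
      (Set.Ioi 1) := by
  have hl2 : 0 < Real.log 2 := Real.log_pos (by norm_num)
  set lam : ℝ → ℝ := fun t => Real.log (f t) / (t * Real.log 2) with hlam
  set g : ℝ → ℝ := (Ici (1:ℝ)).indicator lam with hgdef
  have hgeq : ∀ t, 1 ≤ t → g t = lam t := fun t ht => indicator_of_mem (mem_Ici.mpr ht) _
  have h0 : ∀ x, 0 ≤ g x := by
    intro x
    apply indicator_nonneg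
    intro t ht
    have ht' : (1:ℝ) ≤ t := ht
    have := Real.log_nonneg (h1 t (by linarith))
    simp only [hlam]
    positivity
  have hg : ∀ a b, IntervalIntegrable g volume a b := by
    intro a b
    rw [intervalIntegrable_iff']
    rw [hgdef, IntegrableOn, integrable_indicator_iff measurableSet_Ici, IntegrableOn,
      Measure.restrict_restrict measurableSet_Ici]
    have hcomp : IsCompact (Ici (1:ℝ) ∩ uIcc a b) := isCompact_uIcc.inter_left isClosed_Ici
    have hi := hloc.integrableOn_compact_subset inter_subset_left hcomp
    have hc : ContinuousOn (fun t : ℝ => (t * Real.log 2)⁻¹) (Ici (1:ℝ) ∩ uIcc a b) := by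
      apply ContinuousOn.inv₀ (by fun_prop)
      intro t ht
      have ht' : (1:ℝ) ≤ t := ht.1
      positivity
    exact (hi.mul_continuousOn hc hcomp)
  have hev : ∀ᶠ x in atTop, (2:ℝ) ^ (β/2) < f (2 * x) / f x :=
    (hreg 2 (by norm_num)).eventually_const_lt
      (Real.rpow_lt_rpow_of_exponent_lt (by norm_num) (by linarith))
  obtain ⟨X0, hX0⟩ := eventually_atTop.mp hev
  have hmain := key_aux g hg h0 (max X0 1) (β/2) (le_max_right _ _) (by linarith) (by
    intro t ht
    have ht0 : X0 ≤ t := le_trans (le_max_left _ _) ht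
    have ht1 : 1 ≤ t := le_trans (le_max_right _ _) ht
    rw [hgeq t ht1, hgeq (2*t) (by linarith)]
    have hf1 : 0 < f t := by linarith [h1 t (by linarith)]
    have hf2 : 0 < f (2*t) := by linarith [h1 (2*t) (by linarith)]
    have h := Real.log_lt_log (by positivity) (hX0 t ht0)
    rw [Real.log_rpow (by norm_num), Real.log_div hf2.ne' hf1.ne'] at h
    have htp : 0 < t := by linarith
    have e1 : 2 * lam (2 * t) = Real.log (f (2*t)) / (t * Real.log 2) := by
      simp only [hlam]
      field_simp
    have e2 : lam t + β / 2 * t⁻¹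
        = (Real.log (f t) + β / 2 * Real.log 2) / (t * Real.log 2) := by
      simp only [hlam]
      field_simp
    rw [e1, e2]
    apply div_le_div_of_nonneg_right _ (by positivity)
    linarith)
  refine hmain.congr_fun ?_ measurableSet_Ioi
  intro x hx
  have hx' : (1:ℝ) < x := hx
  have : (∫ t in x..(2*x), g t) = ∫ t in x..(2*x), lam t := by
    apply intervalIntegral.integral_congr
    intro t ht
    rw [uIcc_of_le (by linarith)] at ht
    exact hgeq t (by linarith [ht.1])
  simp only [this, hgeq x hx'.le]
  rfl
end

section
/- Let (b_n)_{n≥1} be a nondecreasing sequence of reals with b_1 ≥ 1, and suppose there is D > 0 with b_n ≤ D·(e↑↑(n−2)) for all n ≥ 2. Let g : (0,∞) → [1,∞) be nondecreasing with g(e↑↑n) = b_n for all n ≥ 1, and define f : (0,∞) → [1,∞) by f(t) = max(1, log^{(1)} t) · max(1, log^{(2)} t)² · Π_{i=3}^∞ max(1, log^{(i)} t) · g(t) (for each t only finitely many factors differ from 1). Then Σ_{n=3}^∞ 1/b_n ≤ ∫_{e↑↑2}^∞ (log f(x))/(x·f(x)) dx, and there exists a constant C > 0, depending only on D, such that ∫_{e↑↑2}^∞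 (log f(x))/(x·f(x)) dx ≤ C·Σ_{n=2}^∞ 1/b_{n−1}. -/
open MeasureTheory Real Set Filter

/-- The power tower `e ↑↑ n`: `towE 0 = 1`, `towE (n+1) = exp (towE n)`. -/
noncomputable def towE : ℕ → ℝ
  | 0 => 1
  | n + 1 => Real.exp (towE n)

/-- Iterated logarithm: `iterLog 0 t = t`, and
`iterLog (n+1) t = log (iterLog n t)` if `iterLog n t > 1`, else `0`. -/
noncomputable def iterLog : ℕ → ℝ → ℝ
  | 0, t => t
  | n + 1, t => if 1 < iterLog n t then Real.log (iterLog n t) else 0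

/-- The function `f(t) = max(1, log^{(1)} t) · max(1, log^{(2)} t)² ·
∏_{i=3}^∞ max(1, log^{(i)} t) · g(t)`; for each `t` only finitely many
factors of the infinite product differ from `1`. -/
noncomputable def F (g : ℝ → ℝ) (t : ℝ) : ℝ :=
  max 1 (iterLog 1 t) * (max 1 (iterLog 2 t)) ^ 2 *
    (∏' i : ℕ, max 1 (iterLog (i + 3) t)) * g t

lemma towE_ge_one (n : ℕ) : 1 ≤ towE n := by
  induction n with
  | zero => simp [towE]
  | succ n ih => rw [towE]; have := Real.add_one_le_exp (towE n); linarith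

lemma towE_succ_ge (n : ℕ) : towE n + 1 ≤ towE (n + 1) := by
  rw [towE]; exact Real.add_one_le_exp (towE n)

lemma towE_mono : Monotone towE :=
  monotone_nat_of_le_succ fun n => by linarith [towE_succ_ge n]

lemma towE_ge_nat (n : ℕ) : (n : ℝ) ≤ towE n := by
  induction n with
  | zero => simp [towE]
  | succ n ih => push_cast; linarith [towE_succ_ge n]

/-- Plain iterated logarithm. -/
noncomputable def lgI : ℕ → ℝ → ℝ
  | 0, t => t
  | n + 1, t => Real.log (lgI n t)

lemma lgI_ge (k : ℕ) : ∀ (i : ℕ) (t : ℝ), towE (i + k) ≤ t → towE i ≤ lgI k t := by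
  induction k with
  | zero => intro i t h; exact h
  | succ k ih =>
    intro i t h
    have h1 := ih (i + 1) t (by rwa [show i + 1 + k = i + (k + 1) by ring])
    rw [lgI, Real.le_log_iff_exp_le (lt_of_lt_of_le (by linarith [towE_ge_one (i+1)]) h1)]
    exact h1

lemma lgI_ge_one {k m : ℕ} (hk : k ≤ m) {t : ℝ} (h : towE m ≤ t) : 1 ≤ lgI k t := by
  have := lgI_ge k 0 t ((towE_mono (by simpa using hk)).trans h)
  simpa [towE] using this

lemma lgI_le (k : ℕ) : ∀ (i : ℕ) (t : ℝ), (∀ l < k, 0 < lgI l t) → t ≤ towE (i + k) →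
    lgI k t ≤ towE i := by
  induction k with
  | zero => intro i t _ h; exact h
  | succ k ih =>
    intro i t hp h
    have h1 := ih (i + 1) t (fun l hl => hp l (by omega))
      (by rwa [show i + 1 + k = i + (k + 1) by ring])
    rw [lgI, Real.log_le_iff_le_exp (hp k (by omega))]
    exact h1

lemma lgI_towE (k i : ℕ) : lgI k (towE (i + k)) = towE i := by
  refine le_antisymm (lgI_le k i _ (fun l hl => ?_) le_rfl) (lgI_ge k i _ le_rfl)
  have := lgI_ge_one (k := l) (m := i + k) (by omega) le_rfl
  linarith

lemma iterLog_eq {m : ℕ} {t : ℝ} (h : towE m ≤ t) : ∀ k ≤ m + 1, iterLog k t = lgI k t := by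
  intro k
  induction k with
  | zero => intro _; rfl
  | succ k ih =>
    intro hk
    have h1 := lgI_ge_one (k := k) (m := m) (by omega) h
    rw [iterLog, lgI, ih (by omega)]
    split_ifs with h2
    · rfl
    · rw [le_antisymm (not_lt.mp h2) h1, Real.log_one]

lemma iterLog_le_one {k : ℕ} {t : ℝ} (h : iterLog k t ≤ 1) (l : ℕ) : iterLog (k + l) t ≤ 1 := by
  induction l with
  | zero => exact h
  | succ l ih =>
    rw [← add_assoc, iterLog, if_neg (not_lt.mpr ih)]; exact zero_le_one

noncomputable def PI (k : ℕ) (t : ℝ) : ℝ := ∏ i ∈ Finset.range k, lgI i t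

lemma hasDerivAt_lgI (k : ℕ) (t : ℝ) (hp : ∀ l < k, 0 < lgI l t) :
    HasDerivAt (lgI k) (1 / PI k t) t := by
  induction k with
  | zero =>
    have e : (1:ℝ) / PI 0 t = 1 := by simp [PI]
    rw [e]; exact hasDerivAt_id t
  | succ k ih =>
    have h1 := (ih (fun l hl => hp l (by omega))).log (hp k (by omega)).ne'
    have e : 1 / PI (k + 1) t = 1 / PI k t / lgI k t := by
      rw [PI, Finset.prod_range_succ, ← PI, div_div]
    rw [e]; exact h1

lemma lint_block (m : ℕ) :
    ∫⁻ x in Set.Ioc (towE m) (towE (m + 1)), ENNReal.ofReal (1 / PI (m + 1) x) = 1 := by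
  have hle : towE m ≤ towE (m + 1) := by linarith [towE_succ_ge m]
  have hpos : ∀ x, towE m ≤ x → ∀ l < m + 1, 0 < lgI l x := fun x hx l hl =>
    lt_of_lt_of_le one_pos (lgI_ge_one (by omega : l ≤ m) hx)
  have hd : ∀ x, towE m ≤ x → HasDerivAt (lgI (m + 1)) (1 / PI (m + 1) x) x :=
    fun x hx => hasDerivAt_lgI _ _ (hpos x hx)
  have hc : ContinuousOn (lgI (m + 1)) (Set.Icc (towE m) (towE (m + 1))) :=
    fun x hx => (hd x hx.1).continuousAt.continuousWithinAt
  have hnn : ∀ x, towE m ≤ x → 0 ≤ 1 / PI (m + 1) x := fun x hx =>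
    one_div_nonneg.mpr (Finset.prod_nonneg fun l hl => (hpos x hx l (by simpa using hl)).le)
  have hint : IntegrableOn (fun x => 1 / PI (m + 1) x) (Set.Ioc (towE m) (towE (m + 1))) :=
    intervalIntegral.integrableOn_deriv_of_nonneg hc (fun x hx => hd x hx.1.le)
      (fun x hx => hnn x hx.1.le)
  have hI := intervalIntegral.integral_eq_sub_of_hasDerivAt_of_le hle hc
    (fun x hx => hd x hx.1.le) ((intervalIntegrable_iff_integrableOn_Ioc_of_le hle).mpr hint)
  rw [intervalIntegral.integral_of_le hle] at hI
  rw [← ofReal_integral_eq_lintegral_ofReal hint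
    ((ae_restrict_iff' measurableSet_Ioc).mpr (Eventually.of_forall fun x hx => hnn x hx.1.le)), hI]
  have h1 : lgI (m + 1) (towE (m + 1)) = 1 := by
    have := lgI_towE (m + 1) 0
    rwa [zero_add] at this
  have h2 : lgI (m + 1) (towE m) = 0 := by
    have := lgI_towE m 0
    rw [zero_add] at this
    rw [lgI, this]; simp [towE]
  rw [h1, h2]; simp

lemma F_eq (g : ℝ → ℝ) (j : ℕ) (t : ℝ) (h1 : towE (j + 2) ≤ t) (h2 : t ≤ towE (j + 3)) :
    F g t = lgI 1 t * lgI 2 t ^ 2 * (∏ i ∈ Finset.range j, lgI (i + 3) t) * g t := by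
  have hmax : ∀ k ≤ j + 2, max 1 (iterLog k t) = lgI k t := fun k hk => by
    rw [iterLog_eq h1 k (by omega), max_eq_right (lgI_ge_one hk h1)]
  have hsm : iterLog (j + 3) t ≤ 1 := by
    rw [iterLog_eq h1 (j + 3) (by omega)]
    have := lgI_le (j + 3) 0 t (fun l hl => lt_of_lt_of_le one_pos
      (lgI_ge_one (by omega : l ≤ j + 2) h1)) (by rwa [zero_add])
    simpa [towE] using this
  have hpr : (∏' i : ℕ, max 1 (iterLog (i + 3) t)) = ∏ i ∈ Finset.range j, lgI (i + 3) t := by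
    rw [tprod_eq_prod (s := Finset.range j)]
    · exact Finset.prod_congr rfl fun i hi => hmax _ (by have := Finset.mem_range.mp hi; omega)
    · intro i hi
      have hi' : j ≤ i := by simpa using hi
      obtain ⟨l, rfl⟩ := Nat.exists_eq_add_of_le hi'
      rw [show j + l + 3 = j + 3 + l by ring]
      exact max_eq_left (iterLog_le_one hsm l)
  rw [F, hpr, hmax 1 (by omega), hmax 2 (by omega)]

lemma PI_eq (j : ℕ) (t : ℝ) :
    PI (j + 3) t = t * lgI 1 t * lgI 2 t * ∏ i ∈ Finset.range j, lgI (i + 3) t := by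
  rw [PI, Finset.prod_range_succ', Finset.prod_range_succ', Finset.prod_range_succ']
  simp only [lgI]; ring

lemma log_le_half {y : ℝ} (hy : 0 < y) : Real.log y ≤ y / 2 := by
  have h := Real.log_le_sub_one_of_pos (show 0 < y / 2 by positivity)
  rw [Real.log_div hy.ne' two_ne_zero] at h
  have := Real.log_two_lt_d9
  linarith

lemma log_prod_le (t : ℝ) (j : ℕ) (hp : ∀ l < j + 3, 1 ≤ lgI l t) :
    Real.log (∏ i ∈ Finset.range j, lgI (i + 3) t) + lgI (j + 3) t ≤ lgI 3 t := by
  induction j with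
  | zero => simp
  | succ j ih =>
    have h1 := ih (fun l hl => hp l (by omega))
    have hpos : 0 < lgI (j + 3) t := lt_of_lt_of_le one_pos (hp _ (by omega))
    have h2 := log_le_half hpos
    rw [Finset.prod_range_succ, Real.log_mul (Finset.prod_pos fun i hi =>
      lt_of_lt_of_le one_pos (hp _ (by have := Finset.mem_range.mp hi; omega))).ne' hpos.ne']
    have e : lgI (j + 1 + 3) t = Real.log (lgI (j + 3) t) := by
      rw [show j + 1 + 3 = (j + 3) + 1 by ring, lgI]
    rw [e]; linarith

lemma block_bounds (D : ℝ) (hD : 0 < D) (g : ℝ → ℝ) (j : ℕ) (t B b : ℝ)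
    (h1 : towE (j + 2) ≤ t) (h2 : t ≤ towE (j + 3)) (hb : 1 ≤ b) (hbg : b ≤ g t) (hgB : g t ≤ B)
    (hB : B ≤ D * towE (j + 1)) :
    1 / B * (1 / PI (j + 3) t) ≤ Real.log (F g t) / (t * F g t) ∧
    Real.log (F g t) / (t * F g t) ≤ (4 + |Real.log D|) * (1 / b) * (1 / PI (j + 3) t) := by
  have hp : ∀ l < j + 3, 1 ≤ lgI l t := fun l hl => lgI_ge_one (by omega : l ≤ j + 2) h1
  set Q := ∏ i ∈ Finset.range j, lgI (i + 3) t with hQ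
  have hQ1 : 1 ≤ Q := Finset.prod_induction _ (fun x : ℝ => 1 ≤ x)
    (fun a b ha hb => one_le_mul_of_one_le_of_one_le ha hb) le_rfl
    (fun i hi => hp _ (by have := Finset.mem_range.mp hi; omega))
  have ht1 : 1 ≤ t := hp 0 (by omega)
  have hl1 : 1 ≤ lgI 1 t := hp 1 (by omega)
  have hl2 : 1 ≤ lgI 2 t := hp 2 (by omega)
  have hg1 : 1 ≤ g t := hb.trans hbg
  have hB1 : 1 ≤ B := hg1.trans hgB
  have hPeq := PI_eq j t
  rw [← hQ] at hPeq
  have hFeq := F_eq g j t h1 h2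
  rw [← hQ] at hFeq
  have hPpos : 0 < PI (j + 3) t := by rw [hPeq]; positivity
  have htF : t * F g t = PI (j + 3) t * lgI 2 t * g t := by rw [hFeq, hPeq]; ring
  have hlogF : Real.log (F g t) =
      lgI 2 t + 2 * lgI 3 t + Real.log Q + Real.log (g t) := by
    rw [hFeq, Real.log_mul (by positivity) (by positivity),
      Real.log_mul (by positivity) (by positivity), Real.log_mul (by positivity) (by positivity),
      Real.log_pow]
    simp only [lgI]; push_cast; ring
  have hl3 : 0 ≤ lgI 3 t := Real.log_nonneg hl2
  have hl3' : lgI 3 t ≤ lgI 2 t / 2 := log_le_half (by linarith)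
  have hlj : 0 ≤ lgI (j + 3) t := Real.log_nonneg (hp (j + 2) (by omega))
  have hQle := log_prod_le t j hp
  rw [← hQ] at hQle
  have hQ0 := Real.log_nonneg hQ1
  have hg0 := Real.log_nonneg hg1
  have htow : 0 < towE (j + 1) := lt_of_lt_of_le one_pos (towE_ge_one _)
  have hlg : Real.log (g t) ≤ |Real.log D| + lgI 2 t := by
    have a1 : Real.log (g t) ≤ Real.log (D * towE (j + 1)) :=
      Real.log_le_log (by linarith) (hgB.trans hB)
    rw [Real.log_mul hD.ne' htow.ne'] at a1
    have a2 : Real.log (towE (j + 1)) ≤ lgI 2 t :=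
      Real.log_le_log htow (lgI_ge 1 (j + 1) t h1)
    linarith [le_abs_self (Real.log D)]
  have habs := abs_nonneg (Real.log D)
  have hlow : lgI 2 t ≤ Real.log (F g t) := by rw [hlogF]; linarith
  have hup : Real.log (F g t) ≤ (4 + |Real.log D|) * lgI 2 t := by
    rw [hlogF]; nlinarith
  have hl2p : 0 < lgI 2 t := by linarith
  have hgp : 0 < g t := by linarith
  have hbp : 0 < b := by linarith
  rw [htF]
  constructor
  · calc 1 / B * (1 / PI (j + 3) t) ≤ 1 / g t * (1 / PI (j + 3) t) := by
          gcongr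
      _ = lgI 2 t / (PI (j + 3) t * lgI 2 t * g t) := by field_simp
      _ ≤ _ := by gcongr
  · calc Real.log (F g t) / (PI (j + 3) t * lgI 2 t * g t)
        ≤ (4 + |Real.log D|) * lgI 2 t / (PI (j + 3) t * lgI 2 t * g t) := by gcongr
      _ = (4 + |Real.log D|) * (1 / g t) * (1 / PI (j + 3) t) := by field_simp
      _ ≤ _ := by gcongr

lemma Ioi_eq_iUnion : Set.Ioi (towE 2) = ⋃ j : ℕ, Set.Ioc (towE (j + 2)) (towE (j + 3)) := by
  ext x
  simp only [Set.mem_Ioi, Set.mem_iUnion, Set.mem_Ioc]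
  constructor
  · intro hx
    have hex : ∃ n : ℕ, x ≤ towE (n + 2) := by
      obtain ⟨n, hn⟩ := exists_nat_ge x
      exact ⟨n, hn.trans ((towE_ge_nat n).trans (towE_mono (by omega)))⟩
    classical
    have hs := Nat.find_spec hex
    have hm := fun k => Nat.find_min hex (m := k)
    rcases hn : Nat.find hex with _ | n
    · rw [hn] at hs; exact absurd hx (not_lt.mpr hs)
    · rw [hn] at hs hm
      exact ⟨n, not_le.mp (hm n (by omega)), by rwa [show n + 3 = n + 1 + 2 by ring]⟩
  · rintro ⟨j, h, _⟩
    exact lt_of_le_of_lt (towE_mono (by omega)) h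

lemma disj_blocks : Pairwise (Function.onFun Disjoint
    (fun j : ℕ => Set.Ioc (towE (j + 2)) (towE (j + 3)))) := by
  have h := (towE_mono.comp (g := towE) (f := fun n : ℕ => n + 2)
    (fun a b hab => by simpa using hab)).pairwise_disjoint_on_Ioc_succ
  exact h

theorem stmt_9 (D : ℝ) (hD : 0 < D) :
    ∃ C > (0:ℝ), ∀ (b : ℕ → ℝ) (g : ℝ → ℝ),
      (∀ n, b n ≤ b (n + 1)) → 1 ≤ b 1 →
      (∀ n, 2 ≤ n → b n ≤ D * towE (n - 2)) →
      (∀ x : ℝ, 0 < x → 1 ≤ g x) →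
      (∀ x y : ℝ, 0 < x → x ≤ y → g x ≤ g y) →
      (∀ n : ℕ, 1 ≤ n → g (towE n) = b n) →
      (∑' k : ℕ, ENNReal.ofReal (1 / b (k + 3))) ≤
          (∫⁻ x in Set.Ioi (towE 2),
            ENNReal.ofReal (Real.log (F g x) / (x * F g x))) ∧
        (∫⁻ x in Set.Ioi (towE 2),
            ENNReal.ofReal (Real.log (F g x) / (x * F g x))) ≤
          ENNReal.ofReal C * ∑' k : ℕ, ENNReal.ofReal (1 / b (k + 1)) := by
  refine ⟨4 + |Real.log D|, by positivity, ?_⟩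
  intro b g hmono hb1 hbD hg1 hgm hgb
  have hb : ∀ n, 1 ≤ b (n + 1) := by
    intro n
    induction n with
    | zero => exact hb1
    | succ n ih => exact ih.trans (hmono _)
  have key : ∀ j : ℕ, ∀ t ∈ Set.Ioc (towE (j + 2)) (towE (j + 3)),
      1 / b (j + 3) * (1 / PI (j + 3) t) ≤ Real.log (F g t) / (t * F g t) ∧
      Real.log (F g t) / (t * F g t) ≤
        (4 + |Real.log D|) * (1 / b (j + 2)) * (1 / PI (j + 3) t) := by
    intro j t ht
    have hp2 : 0 < towE (j + 2) := lt_of_lt_of_le one_pos (towE_ge_one _)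
    refine block_bounds D hD g j t (b (j + 3)) (b (j + 2)) ht.1.le ht.2 (hb (j + 1)) ?_ ?_ ?_
    · rw [← hgb (j + 2) (by omega)]; exact hgm _ _ hp2 ht.1.le
    · rw [← hgb (j + 3) (by omega)]; exact hgm _ _ (hp2.trans ht.1) ht.2
    · exact hbD (j + 3) (by omega)
  have hbp : ∀ n, 0 ≤ 1 / b (n + 1) := fun n =>
    one_div_nonneg.mpr (zero_le_one.trans (hb n))
  have hconst : ∀ (c : ℝ), 0 ≤ c → ∀ j : ℕ,
      ∫⁻ x in Set.Ioc (towE (j + 2)) (towE (j + 3)), ENNReal.ofReal (c * (1 / PI (j + 3) x))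
        = ENNReal.ofReal c := by
    intro c hc j
    simp_rw [ENNReal.ofReal_mul hc]
    rw [lintegral_const_mul' _ _ ENNReal.ofReal_ne_top, lint_block (j + 2), mul_one]
  rw [Ioi_eq_iUnion, lintegral_iUnion (fun _ => measurableSet_Ioc) disj_blocks]
  constructor
  · refine ENNReal.tsum_le_tsum fun j => ?_
    rw [← hconst _ (hbp (j + 2)) j]
    exact setLIntegral_mono' measurableSet_Ioc fun x hx =>
      ENNReal.ofReal_le_ofReal (key j x hx).1
  · have hC : 0 ≤ 4 + |Real.log D| := by positivity
    calc _ ≤ ∑' j : ℕ, ENNReal.ofReal (4 + |Real.log D|) * ENNReal.ofReal (1 / b (j + 2)) := by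
          refine ENNReal.tsum_le_tsum fun j => ?_
          rw [← ENNReal.ofReal_mul hC, ← hconst _ (mul_nonneg hC (hbp (j + 1))) j]
          exact setLIntegral_mono' measurableSet_Ioc fun x hx =>
            ENNReal.ofReal_le_ofReal (key j x hx).2
      _ = ENNReal.ofReal (4 + |Real.log D|) * ∑' j : ℕ, ENNReal.ofReal (1 / b (j + 2)) :=
          ENNReal.tsum_mul_left
      _ ≤ _ := by
          refine mul_le_mul_right ?_ _
          exact ENNReal.tsum_comp_le_tsum_of_injective (add_left_injective 1)
            (fun k : ℕ => ENNReal.ofReal (1 / b (k + 1)))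
end

section
/- Let λ, ν : ℝ → [0,∞) be measurable and locally integrable with λ(t) ≤ ν(t) for all t, let R ≥ 0, M > 0, C ≥ 0, and suppose that ∫_x^{2x+R} (ν(t) − λ(t)) dt ≤ C for all x ≥ M. If ∫_M^∞ exp(−∫_x^{2x+R} λ(t) dt)·λ(x) dx = ∞, then ∫_M^∞ exp(−∫_x^{2x+R} ν(t) dt)·ν(x) dx = ∞. -/
open MeasureTheory Real Set Filter

theorem stmt_11 (lam nu : ℝ → ℝ)
    (hm1 : Measurable lam) (hm2 : Measurable nu)
    (hl1 : LocallyIntegrable lam) (hl2 : LocallyIntegrable nu)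
    (hn1 : ∀ t, 0 ≤ lam t) (hle : ∀ t, lam t ≤ nu t)
    (R M C : ℝ) (hR : 0 ≤ R) (hM : 0 < M) (hC : 0 ≤ C)
    (hbound : ∀ x : ℝ, M ≤ x → (∫ t in x..(2*x + R), nu t - lam t) ≤ C)
    (hdiv : ∫⁻ x in Set.Ioi M,
        ENNReal.ofReal (Real.exp (-(∫ t in x..(2*x + R), lam t)) * lam x) = ⊤) :
    ∫⁻ x in Set.Ioi M,
        ENNReal.ofReal (Real.exp (-(∫ t in x..(2*x + R), nu t)) * nu x) = ⊤ := by
  have hI : ∀ (f : ℝ → ℝ), LocallyIntegrable f → ∀ a b : ℝ, IntervalIntegrable f volume a b := by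
    intro f hf a b
    exact (hf.integrableOn_isCompact isCompact_uIcc).intervalIntegrable
  have hc : ENNReal.ofReal (Real.exp (-C)) * (⊤ : ENNReal) = ⊤ :=
    ENNReal.mul_top (by simpa using Real.exp_pos (-C))
  rw [eq_top_iff, ← hc, ← hdiv, ← lintegral_const_mul' _ _ ENNReal.ofReal_ne_top]
  refine setLIntegral_mono' measurableSet_Ioi fun x hx => ?_
  rw [← ENNReal.ofReal_mul (Real.exp_pos _).le]
  apply ENNReal.ofReal_le_ofReal
  have hb := hbound x (le_of_lt hx)
  rw [intervalIntegral.integral_sub (hI nu hl2 _ _) (hI lam hl1 _ _)] at hb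
  rw [← mul_assoc, ← Real.exp_add]
  exact mul_le_mul (Real.exp_le_exp.mpr (by linarith)) (hle x) (hn1 x) (Real.exp_pos _).le
end

section
/- Let λ and λ' be admissible intensities, let K > 0, and suppose λ(t) ≤ λ'(t) for all t with |t| > K. If λ' satisfies the recurrence criterion, then λ satisfies the recurrence criterion. -/
open MeasureTheory Real Set Filter

/-- A measurable, locally integrable, nonnegative intensity `l : ℝ → [0,∞)`
with infinite mass on both half-lines. -/
def Admissible (l : ℝ → ℝ) : Prop :=
  Measurable l ∧ LocallyIntegrable l ∧ (∀ t, 0 ≤ l t) ∧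
    (∫⁻ t in Set.Ioi (0:ℝ), ENNReal.ofReal (l t) = ⊤) ∧
    (∫⁻ t in Set.Iio (0:ℝ), ENNReal.ofReal (l t) = ⊤)

/-- The recurrence criterion of Theorem 1.1: for every `R ≥ 0` both
recurrence integrals diverge. -/
def RecCrit (l : ℝ → ℝ) : Prop :=
  ∀ R : ℝ, 0 ≤ R →
    (∫⁻ x in Set.Ioi (0:ℝ),
      ENNReal.ofReal (Real.exp (-(∫ t in x..(2*x + R), l t)) * l x) = ⊤) ∧
    (∫⁻ x in Set.Iio (0:ℝ),
      ENNReal.ofReal (Real.exp (-(∫ t in (2*x - R)..x, l t)) * l x) = ⊤)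


lemma ii_of_loc {l : ℝ → ℝ} (hl : LocallyIntegrable l) (a b : ℝ) :
    IntervalIntegrable l volume a b :=
  intervalIntegrable_iff.mpr <|
      (hl.integrableOn_isCompact isCompact_uIcc).mono_set uIoc_subset_uIcc

lemma loc_mul {g l : ℝ → ℝ} (hg : Continuous g) (hl : LocallyIntegrable l) :
    LocallyIntegrable (fun x => g x * l x) := by
  rw [← locallyIntegrableOn_univ] at hl ⊢
  exact hl.continuousOn_mul hg.continuousOn isOpen_univ.isLocallyClosed

lemma cont_prim {l : ℝ → ℝ} (hl : LocallyIntegrable l) :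
    Continuous (fun x => ∫ t in (0:ℝ)..x, l t) :=
  intervalIntegral.continuous_primitive (fun a b => ii_of_loc hl a b) 0

lemma mono_prim {l : ℝ → ℝ} (hl : LocallyIntegrable l) (h0 : ∀ t, 0 ≤ l t) :
    Monotone (fun x => ∫ t in (0:ℝ)..x, l t) := by
  intro x y hxy
  have := intervalIntegral.integral_add_adjacent_intervals (ii_of_loc hl 0 x) (ii_of_loc hl x y)
  have h2 : 0 ≤ ∫ t in x..y, l t := intervalIntegral.integral_nonneg hxy (fun t _ => h0 t)
  simp only
  linarith

lemma ac_prim {l : ℝ → ℝ} (hl : LocallyIntegrable l) (a b : ℝ) :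
    AbsolutelyContinuousOnInterval (fun x => ∫ t in (0:ℝ)..x, l t) a b := by
  have h := (ii_of_loc hl (min (min a b) 0) (max (max a b) 0)).absolutelyContinuousOnInterval_intervalIntegral
    (c := 0) (by rw [uIcc_of_le (by simp)]; simp)
  refine h.mono ?_
  rw [uIcc_of_le (a := min (min a b) 0) (by simp), uIcc]
  exact Icc_subset_Icc (by simp) (by simp)

lemma exp_lip {u v B : ℝ} (hu : u ≤ B) (hv : v ≤ B) :
    dist (exp u) (exp v) ≤ exp B * dist u v := by
  wlog huv : u ≤ v generalizing u v
  · rw [dist_comm, dist_comm u v]; exact this hv hu (le_of_not_ge huv)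
  rw [dist_comm, dist_comm u v, Real.dist_eq, Real.dist_eq, abs_of_nonneg (sub_nonneg.2 (exp_le_exp.2 huv)),
    abs_of_nonneg (sub_nonneg.2 huv)]
  have h1 := Real.add_one_le_exp (u - v)
  have h2 : exp u = exp v * exp (u - v) := by rw [← exp_add]; ring_nf
  have h3 : exp v ≤ exp B := exp_le_exp.2 hv
  have h4 := exp_pos v
  nlinarith

lemma ac_exp {F : ℝ → ℝ} {a b : ℝ} (hF : AbsolutelyContinuousOnInterval F a b) :
    AbsolutelyContinuousOnInterval (fun x => exp (F x)) a b := by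
  obtain ⟨B, hB⟩ := hF.exists_bound
  rw [absolutelyContinuousOnInterval_iff] at hF ⊢
  intro ε hε
  obtain ⟨δ, hδ, h⟩ := hF (ε / exp B) (by positivity)
  refine ⟨δ, hδ, fun E hE hs => ?_⟩
  have h1 := h E hE hs
  rw [lt_div_iff₀ (exp_pos B), Finset.sum_mul] at h1
  refine lt_of_le_of_lt (Finset.sum_le_sum fun i hi => ?_) h1
  rw [mul_comm]
  have := hE.1 i hi
  exact exp_lip ((le_abs_self _).trans (hB _ this.1)) ((le_abs_self _).trans (hB _ this.2))

lemma ae_deriv_exp {l : ℝ → ℝ} (hl : LocallyIntegrable l) :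
    ∀ᵐ x, deriv (fun x => exp (∫ t in (0:ℝ)..x, l t)) x = exp (∫ t in (0:ℝ)..x, l t) * l x := by
  filter_upwards [_root_.LocallyIntegrable.ae_hasDerivAt_integral hl] with x hx
  exact (hx 0).exp.deriv

lemma int_exp {l : ℝ → ℝ} (hl : LocallyIntegrable l) (a b : ℝ) :
    ∫ x in a..b, exp (∫ t in (0:ℝ)..x, l t) * l x =
      exp (∫ t in (0:ℝ)..b, l t) - exp (∫ t in (0:ℝ)..a, l t) := by
  rw [← (ac_exp (ac_prim hl a b)).integral_deriv_eq_sub]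
  apply intervalIntegral.integral_congr_ae
  filter_upwards [ae_deriv_exp hl] with x hx _
  exact hx.symm

/-- integration by parts -/
lemma by_parts {l q : ℝ → ℝ} (hl : LocallyIntegrable l) (hq : LocallyIntegrable q) (a T : ℝ) :
    ∫ x in a..T, exp (∫ t in (0:ℝ)..x, l t) * q x =
      exp (∫ t in (0:ℝ)..a, l t) * (∫ x in a..T, q x) +
      ∫ x in a..T, exp (∫ t in (0:ℝ)..x, l t) * l x * ∫ z in x..T, q z := by
  have hE := ac_exp (ac_prim hl a T)
  have hG := ac_prim hq a T
  have hJ : AbsolutelyContinuousOnInterval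
      (fun x => (∫ t in (0:ℝ)..x, q t) + (-(∫ t in (0:ℝ)..T, q t))) a T := by
    refine hG.fun_add ?_
    exact (LipschitzWith.const _ : LipschitzWith 0 _).lipschitzOnWith.absolutelyContinuousOnInterval
  have h := hE.integral_mul_deriv_eq_deriv_mul hJ
  have e1 : ∫ x in a..T, exp (∫ t in (0:ℝ)..x, l t) *
      deriv (fun x => (∫ t in (0:ℝ)..x, q t) + (-(∫ t in (0:ℝ)..T, q t))) x =
      ∫ x in a..T, exp (∫ t in (0:ℝ)..x, l t) * q x := by
    apply intervalIntegral.integral_congr_ae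
    filter_upwards [_root_.LocallyIntegrable.ae_hasDerivAt_integral hq] with x hx _
    rw [((hx 0).add_const _).deriv]
  have e3 (x : ℝ) : (∫ t in (0:ℝ)..x, q t) + (-(∫ t in (0:ℝ)..T, q t)) = - ∫ z in x..T, q z := by
    rw [← intervalIntegral.integral_add_adjacent_intervals (ii_of_loc hq 0 x) (ii_of_loc hq x T)]
    ring
  have e2 : ∫ x in a..T, deriv (fun x => exp (∫ t in (0:ℝ)..x, l t)) x *
      ((∫ t in (0:ℝ)..x, q t) + (-(∫ t in (0:ℝ)..T, q t))) =
      - ∫ x in a..T, exp (∫ t in (0:ℝ)..x, l t) * l x * ∫ z in x..T, q z := by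
    rw [← intervalIntegral.integral_neg (f := fun x => exp (∫ t in (0:ℝ)..x, l t) * l x * ∫ z in x..T, q z)]
    apply intervalIntegral.integral_congr_ae
    filter_upwards [ae_deriv_exp hl] with x hx _
    rw [hx, e3]; ring
  rw [e1, e2, e3, e3] at h
  rw [h]; simp

/-- the exponent decays -/
lemma step1 {l : ℝ → ℝ} (hl : LocallyIntegrable l) (h0 : ∀ t, 0 ≤ l t)
    (hT : Tendsto (fun x => ∫ t in (0:ℝ)..x, l t) atTop atTop) (R : ℝ)
    (hint : IntegrableOn (fun x => exp (-((∫ t in (0:ℝ)..(2*x+R), l t) - ∫ t in (0:ℝ)..x, l t)) * l x)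
      (Ioi 0)) :
    ∀ᶠ b in atTop, exp (-(∫ t in (0:ℝ)..(2*b+R), l t)) ≤ exp (-(∫ t in (0:ℝ)..b, l t)) / 2 := by
  set L : ℝ → ℝ := fun x => ∫ t in (0:ℝ)..x, l t with hL
  set f : ℝ → ℝ := fun x => exp (-(L (2*x+R) - L x)) * l x with hf
  have hf0 : ∀ x, 0 ≤ f x := fun x => mul_nonneg (exp_pos _).le (h0 x)
  have hLm : Monotone L := mono_prim hl h0
  have hLc : Continuous L := cont_prim hl
  have hfl : LocallyIntegrable f := loc_mul (by fun_prop) hl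
  have ht : Tendsto (fun T => ∫ x in (0:ℝ)..T, f x) atTop (nhds (∫ x in Ioi 0, f x)) :=
    intervalIntegral_tendsto_integral_Ioi 0 hint tendsto_id
  obtain ⟨a, ha, ha0⟩ := ((ht.eventually (lt_mem_nhds (show (∫ x in Ioi 0, f x) - 1/4 < _ by linarith))).and
    (eventually_ge_atTop 0)).exists
  filter_upwards [hT.eventually (eventually_ge_atTop (L a + log 2)), eventually_ge_atTop a] with b hb hab
  have hle : ∫ x in (0:ℝ)..b, f x ≤ ∫ x in Ioi 0, f x := by
    rw [intervalIntegral.integral_of_le (by linarith)]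
    exact setIntegral_mono_set hint (ae_of_all _ hf0) (Ioc_subset_Ioi_self).eventuallyLE
  have hadd := intervalIntegral.integral_add_adjacent_intervals (ii_of_loc hfl 0 a) (ii_of_loc hfl a b)
  have h4 : ∫ x in a..b, f x ≤ 1/4 := by linarith
  have h5 : exp (-L (2*b+R)) * (exp (L b) - exp (L a)) ≤ ∫ x in a..b, f x := by
    rw [← int_exp hl a b, ← intervalIntegral.integral_const_mul]
    apply intervalIntegral.integral_mono_on hab
    · exact ii_of_loc (loc_mul continuous_const (loc_mul (hLc.rexp) hl)) a b
    · exact ii_of_loc hfl a b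
    · intro x hx
      simp only [hf]
      rw [← mul_assoc, ← exp_add]
      refine mul_le_mul_of_nonneg_right (exp_le_exp.2 ?_) (h0 x)
      have := hLm (show 2*x+R ≤ 2*b+R by linarith [hx.2])
      change -L (2*b+R) + L x ≤ _
      linarith
  have h6 : exp (L a) ≤ exp (L b) / 2 := by
    rw [le_div_iff₀ two_pos]
    calc exp (L a) * 2 = exp (L a + log 2) := by rw [exp_add, exp_log two_pos]
      _ ≤ _ := exp_le_exp.2 hb
  change exp (-L (2*b+R)) ≤ exp (-L b) / 2
  have h7 : exp (-L (2*b+R)) * (exp (L b) / 2) ≤ 1/4 := by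
    refine le_trans (le_trans ?_ h5) h4
    refine mul_le_mul_of_nonneg_left ?_ (exp_pos _).le
    linarith
  rw [exp_neg (L b), le_div_iff₀ two_pos, inv_eq_one_div, le_div_iff₀ (exp_pos _)]
  linarith

lemma block {l m : ℝ → ℝ} (hl : LocallyIntegrable l) (h0 : ∀ t, 0 ≤ l t)
    (hm : LocallyIntegrable m) (m0 : ∀ t, 0 ≤ m t) (R : ℝ) (L M : ℝ → ℝ)
    (hL : L = fun x => ∫ t in (0:ℝ)..x, l t) (hM : M = fun x => ∫ t in (0:ℝ)..x, m t)
    (x w : ℝ) (hxw : x ≤ w) (hw : w ≤ 2*x+R) :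
    ∫ z in x..w, exp (-L (2*z+R)) * exp (-(M (2*z+R) - M z)) * m z ≤ exp (-L (2*x+R)) := by
  have hLm : Monotone L := hL ▸ mono_prim hl h0
  have hLc : Continuous L := hL ▸ cont_prim hl
  have hMm : Monotone M := hM ▸ mono_prim hm m0
  have hMc : Continuous M := hM ▸ cont_prim hm
  have h1 : ∫ z in x..w, exp (-L (2*z+R)) * exp (-(M (2*z+R) - M z)) * m z ≤
      ∫ z in x..w, (exp (-L (2*x+R)) * exp (-M (2*x+R))) * (exp (M z) * m z) := by
    apply intervalIntegral.integral_mono_on hxw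
    · exact ii_of_loc (loc_mul (by fun_prop) hm) _ _
    · exact ii_of_loc (loc_mul continuous_const (loc_mul (by fun_prop) hm)) _ _
    · intro z hz
      rw [← mul_assoc]
      refine mul_le_mul_of_nonneg_right ?_ (m0 z)
      rw [← exp_add, ← exp_add, ← exp_add]
      refine exp_le_exp.2 ?_
      have := hLm (show 2*x+R ≤ 2*z+R by linarith [hz.1])
      have := hMm (show 2*x+R ≤ 2*z+R by linarith [hz.1])
      linarith
  have h2 : ∫ z in x..w, (exp (M z) * m z) = exp (M w) - exp (M x) := by
    rw [hM]; exact int_exp hm x w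
  rw [intervalIntegral.integral_const_mul, h2] at h1
  have h3 : exp (-M (2*x+R)) * (exp (M w) - exp (M x)) ≤ 1 := by
    calc _ ≤ exp (-M (2*x+R)) * exp (M w) := by
          refine mul_le_mul_of_nonneg_left ?_ (exp_pos _).le
          linarith [exp_pos (M x)]
      _ = exp (-M (2*x+R) + M w) := by rw [exp_add]
      _ ≤ 1 := by
        rw [exp_le_one_iff]; linarith [hMm hw]
  rw [mul_assoc] at h1
  have := mul_le_mul_of_nonneg_left h3 (exp_pos (-L (2*x+R))).le
  linarith

lemma Jbound {l m : ℝ → ℝ} (hl : LocallyIntegrable l) (h0 : ∀ t, 0 ≤ l t)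
    (hm : LocallyIntegrable m) (m0 : ∀ t, 0 ≤ m t) (R : ℝ) (hR : 0 ≤ R) (L M : ℝ → ℝ)
    (hL : L = fun x => ∫ t in (0:ℝ)..x, l t) (hM : M = fun x => ∫ t in (0:ℝ)..x, m t)
    (b₀ T : ℝ) (hb₀ : 0 < b₀) (hb : ∀ b, b₀ ≤ b → exp (-L (2*b+R)) ≤ exp (-L b) / 2) (n : ℕ) :
    ∀ x, b₀ ≤ x → x ≤ T → T ≤ x * 2 ^ n →
    ∫ z in x..T, exp (-L (2*z+R)) * exp (-(M (2*z+R) - M z)) * m z ≤ 2 * exp (-L (2*x+R)) := by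
  have hLc : Continuous L := hL ▸ cont_prim hl
  have hMc : Continuous M := hM ▸ cont_prim hm
  induction n with
  | zero =>
    intro x hx hxT hT
    have : x = T := by simp at hT; linarith
    subst this
    simp [exp_pos, le_of_lt]
  | succ n ih =>
    intro x hx hxT hT
    have hp := exp_pos (-L (2*x+R))
    rcases le_total T (2*x+R) with h | h
    · have := block hl h0 hm m0 R L M hL hM x T hxT h
      linarith
    · have h1 := block hl h0 hm m0 R L M hL hM x (2*x+R) (by linarith) le_rfl
      have h2 := ih (2*x+R) (by linarith) h (by
        rw [pow_succ] at hT
        have : (0:ℝ) ≤ R * 2^n := by positivity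
        nlinarith)
      have h3 := hb (2*x+R) (by linarith)
      have hq : LocallyIntegrable (fun z => exp (-L (2*z+R)) * exp (-(M (2*z+R) - M z)) * m z) :=
        loc_mul (by fun_prop) hm
      rw [← intervalIntegral.integral_add_adjacent_intervals (ii_of_loc hq x (2*x+R)) (ii_of_loc hq _ T)]
      linarith

lemma core {l m : ℝ → ℝ} (hl : LocallyIntegrable l) (h0 : ∀ t, 0 ≤ l t)
    (hm : LocallyIntegrable m) (m0 : ∀ t, 0 ≤ m t) (R : ℝ) (hR : 0 ≤ R) (L M : ℝ → ℝ)
    (hL : L = fun x => ∫ t in (0:ℝ)..x, l t) (hM : M = fun x => ∫ t in (0:ℝ)..x, m t)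
    (hT : Tendsto L atTop atTop)
    (hint : IntegrableOn (fun x => exp (-(L (2*x+R) - L x)) * l x) (Ioi 0)) (K : ℝ) :
    ∃ a, K ≤ a ∧ 0 < a ∧ IntegrableOn
      (fun x => exp (-(L (2*x+R) - L x) + -(M (2*x+R) - M x)) * (l x + m x)) (Ioi a) := by
  have hLm : Monotone L := hL ▸ mono_prim hl h0
  have hLc : Continuous L := hL ▸ cont_prim hl
  have hMm : Monotone M := hM ▸ mono_prim hm m0
  have hMc : Continuous M := hM ▸ cont_prim hm
  have hs : ∀ᶠ b in atTop, exp (-L (2*b+R)) ≤ exp (-L b) / 2 := by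
    subst hL; exact step1 hl h0 hT R hint
  obtain ⟨b₁, hb₁⟩ := eventually_atTop.1 hs
  set a := max (max b₁ K) 1 with ha
  have ha1 : 1 ≤ a := le_max_right _ _
  have haK : K ≤ a := (le_max_right _ _).trans (le_max_left _ _)
  have hab : b₁ ≤ a := (le_max_left _ _).trans (le_max_left _ _)
  have hb : ∀ b, a ≤ b → exp (-L (2*b+R)) ≤ exp (-L b) / 2 := fun b h => hb₁ b (hab.trans h)
  refine ⟨a, haK, by linarith, ?_⟩
  set f : ℝ → ℝ := fun x => exp (-(L (2*x+R) - L x)) * l x with hf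
  have hf0 : ∀ x, 0 ≤ f x := fun x => mul_nonneg (exp_pos _).le (h0 x)
  have hfl : LocallyIntegrable f := loc_mul (by fun_prop) hl
  set q : ℝ → ℝ := fun z => exp (-L (2*z+R)) * exp (-(M (2*z+R) - M z)) * m z with hq
  have hql : LocallyIntegrable q := loc_mul (by fun_prop) hm
  have hq0 : ∀ x, 0 ≤ q x := fun x => mul_nonneg (by positivity) (m0 x)
  have hJ : ∀ T x, a ≤ x → x ≤ T → ∫ z in x..T, q z ≤ 2 * exp (-L (2*x+R)) := by
    intro T x hx hxT
    obtain ⟨n, hn⟩ := pow_unbounded_of_one_lt (T / x) (one_lt_two : (1:ℝ) < 2)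
    have hx0 : 0 < x := by linarith
    rw [div_lt_iff₀ hx0] at hn
    exact Jbound hl h0 hm m0 R hR L M hL hM a T (by linarith) hb n x hx hxT (by linarith)
  have hgl : LocallyIntegrable
      (fun x => exp (-(L (2*x+R) - L x) + -(M (2*x+R) - M x)) * (l x + m x)) :=
    loc_mul (by fun_prop) (hl.add hm)
  set C := ∫ x in Ioi 0, f x with hC
  refine integrableOn_Ioi_of_intervalIntegral_norm_bounded (l := atTop) (b := id) (3 * C + 2) a
    (fun i => (hgl.integrableOn_isCompact isCompact_Icc).mono_set Ioc_subset_Icc_self) tendsto_id ?_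
  filter_upwards [eventually_ge_atTop a] with T haT
  simp only [id]
  have hfC : ∫ x in a..T, f x ≤ C := by
    rw [intervalIntegral.integral_of_le haT]
    exact setIntegral_mono_set hint (ae_of_all _ hf0)
      (LE.le.eventuallyLE fun x hx => lt_trans (by linarith) hx.1)
  have hEq : LocallyIntegrable (fun x => exp (L x) * q x) := loc_mul (by fun_prop) hql
  have hA : ∫ x in a..T, ‖exp (-(L (2*x+R) - L x) + -(M (2*x+R) - M x)) * (l x + m x)‖ ≤
      ∫ x in a..T, (f x + exp (L x) * q x) := by
    apply intervalIntegral.integral_mono_on haT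
    · exact (ii_of_loc hgl a T).norm
    · exact (ii_of_loc hfl a T).add (ii_of_loc hEq a T)
    · intro x hx
      rw [norm_of_nonneg (mul_nonneg (exp_pos _).le (add_nonneg (h0 x) (m0 x))), mul_add]
      refine add_le_add ?_ (le_of_eq ?_)
      · refine mul_le_mul_of_nonneg_right (exp_le_exp.2 ?_) (h0 x)
        linarith [hMm (show x ≤ 2*x+R by linarith [hx.1])]
      · simp only [hq]
        rw [← mul_assoc, ← exp_add, ← exp_add]
        congr 2; ring
  have hB := by_parts hl hql a T
  have hB' : ∫ x in a..T, exp (L x) * q x = exp (L a) * (∫ x in a..T, q x) +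
      ∫ x in a..T, exp (L x) * l x * ∫ z in x..T, q z := by rw [hL]; exact hB
  have hJc : Continuous (fun x => ∫ z in x..T, q z) := by
    have : (fun x => ∫ z in x..T, q z) = fun x => - ∫ z in T..x, q z := by
      funext x; rw [intervalIntegral.integral_symm]
    rw [this]
    exact (intervalIntegral.continuous_primitive (fun a b => ii_of_loc hql a b) T).neg
  have hD : ∫ x in a..T, exp (L x) * l x * ∫ z in x..T, q z ≤ ∫ x in a..T, 2 * f x := by
    apply intervalIntegral.integral_mono_on haT
    · have := ii_of_loc (loc_mul hJc (loc_mul hLc.rexp hl)) a T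
      refine this.congr ?_
      intro x _
      exact mul_comm (∫ z in x..T, q z) (exp (L x) * l x)
    · exact (ii_of_loc hfl a T).const_mul 2
    · intro x hx
      have h1 := mul_le_mul_of_nonneg_left (hJ T x hx.1 hx.2)
        (mul_nonneg (exp_pos (L x)).le (h0 x))
      refine h1.trans (le_of_eq ?_)
      simp only [hf]
      rw [show -(L (2*x+R) - L x) = L x + -L (2*x+R) by ring, exp_add]
      ring
  have hF : exp (L a) * (∫ x in a..T, q x) ≤ 2 := by
    have h1 := mul_le_mul_of_nonneg_left (hJ T a le_rfl haT) (exp_pos (L a)).le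
    have h2 : exp (L a) * exp (-L (2*a+R)) ≤ 1 := by
      rw [← exp_add, exp_le_one_iff]; linarith [hLm (show a ≤ 2*a+R by linarith)]
    linarith
  rw [intervalIntegral.integral_add (ii_of_loc hfl a T) (ii_of_loc hEq a T)] at hA
  rw [intervalIntegral.integral_const_mul] at hD
  linarith

/-- nonnegative functions: finite lower integral versus integrability -/
lemma top_iff {g : ℝ → ℝ} {s : Set ℝ} (hg : AEStronglyMeasurable g (volume.restrict s))
    (h0 : ∀ x, 0 ≤ g x) :
    (∫⁻ x in s, ENNReal.ofReal (g x) = ⊤) ↔ ¬ IntegrableOn g s := by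
  rw [IntegrableOn, Integrable, hasFiniteIntegral_iff_ofReal (ae_of_all _ h0), lt_top_iff_ne_top]
  simp [hg]

lemma prim_tendsto {l : ℝ → ℝ} (hl : LocallyIntegrable l) (h0 : ∀ t, 0 ≤ l t)
    (hi : ∫⁻ t in Ioi (0:ℝ), ENNReal.ofReal (l t) = ⊤) :
    Tendsto (fun x => ∫ t in (0:ℝ)..x, l t) atTop atTop := by
  rcases tendsto_atTop_of_monotone (mono_prim hl h0) with h | ⟨I, h⟩
  · exact h
  · exfalso
    rw [top_iff hl.aestronglyMeasurable.restrict h0] at hi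
    apply hi
    refine integrableOn_Ioi_of_intervalIntegral_norm_tendsto (l := atTop) (b := id) I 0
      (fun i => (hl.integrableOn_isCompact isCompact_Icc).mono_set Ioc_subset_Icc_self) tendsto_id ?_
    simpa [abs_of_nonneg (h0 _)] using h

lemma prim_sub {l : ℝ → ℝ} (hl : LocallyIntegrable l) (a b : ℝ) :
    ∫ t in a..b, l t = (∫ t in (0:ℝ)..b, l t) - ∫ t in (0:ℝ)..a, l t := by
  rw [← intervalIntegral.integral_add_adjacent_intervals (ii_of_loc hl 0 a) (ii_of_loc hl a b)]
  ring

lemma half {l l' : ℝ → ℝ} (hl : LocallyIntegrable l) (h0 : ∀ t, 0 ≤ l t)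
    (hl' : LocallyIntegrable l') (h0' : ∀ t, 0 ≤ l' t)
    (hi : ∫⁻ t in Ioi (0:ℝ), ENNReal.ofReal (l t) = ⊤) (K : ℝ) (hle : ∀ t, K < t → l t ≤ l' t)
    (R : ℝ) (hR : 0 ≤ R)
    (h : ∫⁻ x in Ioi (0:ℝ), ENNReal.ofReal (exp (-(∫ t in x..(2*x + R), l' t)) * l' x) = ⊤) :
    ∫⁻ x in Ioi (0:ℝ), ENNReal.ofReal (exp (-(∫ t in x..(2*x + R), l t)) * l x) = ⊤ := by
  have key : ∀ {k : ℝ → ℝ}, LocallyIntegrable k →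
      LocallyIntegrable (fun x => exp (-(∫ t in x..(2*x + R), k t)) * k x) := by
    intro k hk
    rw [show (fun x => exp (-(∫ t in x..(2*x + R), k t)) * k x) = fun x =>
      exp (-((∫ t in (0:ℝ)..(2*x + R), k t) - ∫ t in (0:ℝ)..x, k t)) * k x from
      funext fun x => by rw [prim_sub hk x]]
    have := cont_prim hk
    have h2 : Continuous (fun x => ∫ t in (0:ℝ)..(2*x+R), k t) :=
      this.comp (show Continuous fun x : ℝ => 2*x+R by fun_prop)
    exact loc_mul (by fun_prop) hk
  rw [top_iff (key hl').aestronglyMeasurable.restrict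
    (fun x => mul_nonneg (exp_pos _).le (h0' x))] at h
  rw [top_iff (key hl).aestronglyMeasurable.restrict (fun x => mul_nonneg (exp_pos _).le (h0 x))]
  intro hint
  apply h
  set m : ℝ → ℝ := fun t => max (l' t - l t) 0 with hm
  have m0 : ∀ t, 0 ≤ m t := fun t => le_max_right _ _
  have hml : LocallyIntegrable m := by
    refine (hl'.sub hl).mono ?_ ?_
    · exact (hl'.sub hl).aestronglyMeasurable.sup aestronglyMeasurable_const
    · filter_upwards with x
      rw [norm_of_nonneg (m0 x)]
      exact max_le (le_abs_self _) (abs_nonneg _)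
  rw [show (fun x => exp (-(∫ t in x..(2*x + R), l t)) * l x) = fun x =>
      exp (-((∫ t in (0:ℝ)..(2*x + R), l t) - ∫ t in (0:ℝ)..x, l t)) * l x from
      funext fun x => by rw [prim_sub hl x]] at hint
  obtain ⟨a, hKa, ha0, hI⟩ := core hl h0 hml m0 R hR _ _ rfl rfl (prim_tendsto hl h0 hi) hint K
  rw [← Ioc_union_Ioi_eq_Ioi ha0.le]
  refine IntegrableOn.union
    (((key hl').integrableOn_isCompact isCompact_Icc).mono_set Ioc_subset_Icc_self) ?_
  refine hI.congr_fun ?_ measurableSet_Ioi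
  intro x hx
  have hx : a < x := hx
  have hlm : ∀ t, K < t → l t + m t = l' t := by
    intro t ht
    simp only [hm]
    rw [max_eq_left (by linarith [hle t ht])]; ring
  have e : ∫ t in x..(2*x+R), l' t = (∫ t in x..(2*x+R), l t) + ∫ t in x..(2*x+R), m t := by
    rw [← intervalIntegral.integral_add (ii_of_loc hl _ _) (ii_of_loc hml _ _)]
    apply intervalIntegral.integral_congr
    intro t ht
    rw [uIcc_of_le (by linarith)] at ht
    exact (hlm t (by linarith [ht.1])).symm
  simp only
  rw [hlm x (by linarith), e, prim_sub hl x, prim_sub hml x]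
  congr 2
  ring

lemma refl_lint (F : ℝ → ENNReal) : ∫⁻ x in Iio (0:ℝ), F x = ∫⁻ x in Ioi (0:ℝ), F (-x) := by
  have := (Measure.measurePreserving_neg (volume : Measure ℝ)).setLIntegral_comp_preimage_emb
    (MeasurableEquiv.neg ℝ).measurableEmbedding F (Iio 0)
  rw [← this]
  congr 2
  ext x; simp

lemma refl_loc {l : ℝ → ℝ} (hl : LocallyIntegrable l) : LocallyIntegrable (fun x => l (-x)) := by
  have h := locallyIntegrable_map_homeomorph (Homeomorph.neg ℝ) (f := l) (μ := volume)
  have e : Measure.map (Homeomorph.neg ℝ) (volume : Measure ℝ) = volume :=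
    (Measure.measurePreserving_neg (volume : Measure ℝ)).map_eq
  rw [e] at h
  exact h.1 hl

lemma refl_crit (l : ℝ → ℝ) (R : ℝ) :
    ∫⁻ x in Iio (0:ℝ), ENNReal.ofReal (exp (-(∫ t in (2*x - R)..x, l t)) * l x) =
    ∫⁻ x in Ioi (0:ℝ), ENNReal.ofReal (exp (-(∫ t in x..(2*x + R), l (-t))) * l (-x)) := by
  rw [refl_lint]
  congr 1
  funext x
  rw [intervalIntegral.integral_comp_neg]
  congr 5
  ring

theorem stmt_12 (lam lam' : ℝ → ℝ)
    (hlam : Admissible lam) (hlam' : Admissible lam')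
    (K : ℝ) (hK : 0 < K)
    (hle : ∀ t : ℝ, K < |t| → lam t ≤ lam' t)
    (hrec : RecCrit lam') : RecCrit lam := by
  obtain ⟨_, hl, h0, hp, hn⟩ := hlam
  obtain ⟨_, hl', h0', -, -⟩ := hlam'
  intro R hR
  obtain ⟨r1, r2⟩ := hrec R hR
  refine ⟨half hl h0 hl' h0' hp K (fun t ht => hle t (lt_of_lt_of_le ht (le_abs_self t))) R hR r1, ?_⟩
  rw [refl_crit] at r2 ⊢
  rw [refl_lint] at hn
  exact half (refl_loc hl) (fun t => h0 _) (refl_loc hl') (fun t => h0' _) hn K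
    (fun t ht => hle _ (by rw [abs_neg]; exact lt_of_lt_of_le ht (le_abs_self t))) R hR r2
end

section
/- Define λ₁ : ℝ → [0,∞) by λ₁(t) = Σ_{n=1}^∞ 1_{(2^{2n}, 2^{2n+1})}(t) for t > 0 and λ₁(t) = 0 for t ≤ 0. Then ∫_0^∞ exp(−∫_x^{2x} λ₁(t) dt)·λ₁(x) dx = ∞. -/
open MeasureTheory Real Set Filter

/-- The intensity `λ₁(t) = Σ_{n=1}^∞ 1_{(2^{2n}, 2^{2n+1})}(t)` for `t > 0`
(and `λ₁(t) = 0` for `t ≤ 0`, automatically). -/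
noncomputable def lam1 : ℝ → ℝ := fun t =>
  ∑' n : ℕ, if (2:ℝ) ^ (2 * (n + 1)) < t ∧ t < (2:ℝ) ^ (2 * (n + 1) + 1) then 1 else 0

theorem two_pow_mono {a b : ℕ} (h : a ≤ b) : (2:ℝ) ^ a ≤ 2 ^ b :=
  pow_le_pow_right₀ (by norm_num) h

theorem lam1_one (m : ℕ) (t : ℝ) (h1 : (2:ℝ) ^ (2 * (m + 1)) < t)
    (h2 : t < (2:ℝ) ^ (2 * (m + 1) + 1)) : lam1 t = 1 := by
  unfold lam1
  rw [tsum_eq_single m]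
  · rw [if_pos ⟨h1, h2⟩]
  · intro n hn
    rw [if_neg]
    rintro ⟨h3, h4⟩
    rcases lt_or_gt_of_ne hn with h | h
    · have := two_pow_mono (show 2 * (n + 1) + 1 ≤ 2 * (m + 1) by omega)
      linarith
    · have := two_pow_mono (show 2 * (m + 1) + 1 ≤ 2 * (n + 1) by omega)
      linarith

theorem lam1_zero (m : ℕ) (t : ℝ) (h1 : (2:ℝ) ^ (2 * (m + 1) + 1) ≤ t)
    (h2 : t ≤ (2:ℝ) ^ (2 * (m + 1) + 2)) : lam1 t = 0 := by
  unfold lam1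
  convert tsum_zero with n
  rw [if_neg]
  rintro ⟨h3, h4⟩
  rcases le_or_gt n m with h | h
  · have := two_pow_mono (show 2 * (n + 1) + 1 ≤ 2 * (m + 1) + 1 by omega)
    linarith
  · have := two_pow_mono (show 2 * (m + 1) + 2 ≤ 2 * (n + 1) by omega)
    linarith

theorem lam1_integral (m : ℕ) (x : ℝ) (h1 : (2:ℝ) ^ (2 * (m + 1)) < x)
    (h2 : x < (2:ℝ) ^ (2 * (m + 1) + 1)) :
    ∫ t in x..(2*x), lam1 t = (2:ℝ) ^ (2 * (m + 1) + 1) - x := by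
  have hx : 0 < x := lt_trans (by positivity) h1
  have e1 : (2:ℝ) ^ (2 * (m + 1) + 1) = 2 * 2 ^ (2 * (m + 1)) := by ring
  have e2 : (2:ℝ) ^ (2 * (m + 1) + 2) = 2 * 2 ^ (2 * (m + 1) + 1) := by ring
  rw [intervalIntegral.integral_of_le (by linarith)]
  have : ∀ t ∈ Ioc x (2*x), lam1 t =
      (Ioo x ((2:ℝ) ^ (2 * (m + 1) + 1))).indicator (fun _ => (1:ℝ)) t := by
    rintro t ⟨ht1, ht2⟩
    by_cases h : t < (2:ℝ) ^ (2 * (m + 1) + 1)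
    · rw [indicator_of_mem (mem_Ioo.2 ⟨ht1, h⟩), lam1_one m t (by linarith) h]
    · rw [indicator_of_notMem (fun h' => h h'.2), lam1_zero m t (not_lt.1 h) (by linarith)]
  rw [setIntegral_congr_fun measurableSet_Ioc this, setIntegral_indicator measurableSet_Ioo,
    inter_eq_self_of_subset_right]
  · simp [h2.le]
  · rintro t ⟨ht1, ht2⟩
    exact ⟨ht1, by linarith⟩

theorem stmt_15 :
    ∫⁻ x in Set.Ioi (0:ℝ),
      ENNReal.ofReal (Real.exp (-(∫ t in x..(2*x), lam1 t)) * lam1 x) = ⊤ := by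
  set f : ℝ → ENNReal := fun x =>
    ENNReal.ofReal (Real.exp (-(∫ t in x..(2*x), lam1 t)) * lam1 x) with hf
  let S : ℕ → Set ℝ := fun m => Ioo ((2:ℝ) ^ (2 * (m + 1) + 1) - 1) ((2:ℝ) ^ (2 * (m + 1) + 1))
  have low : ∀ m : ℕ, (2:ℝ) ^ (2 * (m + 1)) ≤ (2:ℝ) ^ (2 * (m + 1) + 1) - 1 := by
    intro m
    have e1 : (2:ℝ) ^ (2 * (m + 1) + 1) = 2 * 2 ^ (2 * (m + 1)) := by ring
    have : (1:ℝ) ≤ 2 ^ (2 * (m + 1)) := one_le_pow₀ (by norm_num)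
    linarith
  have hdis : Pairwise (Function.onFun Disjoint S) := by
    refine (pairwise_disjoint_on S).2 ?_
    intro m n h
    rw [Set.disjoint_left]
    rintro x ⟨_, h2⟩ ⟨h3, _⟩
    have := two_pow_mono (show 2 * (m + 1) + 1 ≤ 2 * (n + 1) by omega)
    linarith [low n]
  have hsub : (⋃ m, S m) ⊆ Ioi (0:ℝ) := by
    refine iUnion_subset fun m x hx => ?_
    have : (0:ℝ) < 2 ^ (2 * (m + 1)) := by positivity
    have := hx.1
    exact mem_Ioi.2 (by linarith [low m])
  have hS : ∀ m, ENNReal.ofReal (Real.exp (-1)) ≤ ∫⁻ x in S m, f x := by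
    intro m
    calc ENNReal.ofReal (Real.exp (-1)) = ∫⁻ _ in S m, ENNReal.ofReal (Real.exp (-1)) := by
          rw [setLIntegral_const]; simp [S]
      _ ≤ _ := by
          refine setLIntegral_mono' measurableSet_Ioo fun x hx => ?_
          have h1 : (2:ℝ) ^ (2 * (m + 1)) < x := lt_of_le_of_lt (low m) hx.1
          simp only [hf]
          rw [lam1_integral m x h1 hx.2, lam1_one m x h1 hx.2, mul_one]
          refine ENNReal.ofReal_le_ofReal (Real.exp_le_exp.2 ?_)
          linarith [hx.1]
  rw [eq_top_iff]
  calc (⊤ : ENNReal) = ∑' _ : ℕ, ENNReal.ofReal (Real.exp (-1)) := by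
        rw [ENNReal.tsum_const_eq_top_of_ne_zero]
        simp [Real.exp_pos]
    _ ≤ ∑' m, ∫⁻ x in S m, f x := ENNReal.tsum_le_tsum hS
    _ = ∫⁻ x in ⋃ m, S m, f x := (lintegral_iUnion (fun _ => measurableSet_Ioo) hdis f).symm
    _ ≤ _ := lintegral_mono_set hsub
end

section
/- Define λ₂ : ℝ → [0,∞) by λ₂(t) = Σ_{n=1}^∞ n·1_{(2^n−2, 2^n−1)}(t) for t > 0. Then liminf_{t→∞} t·λ₂(t)/log^{(2)} t = 0 and limsup_{t→∞} t·λ₂(t)/log^{(2)} t = ∞. -/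
open MeasureTheory Real Set Filter

/-- The intensity `λ₂(t) = Σ_{n=1}^∞ n · 1_{(2^n − 2, 2^n − 1)}(t)` for `t > 0`. -/
noncomputable def lam2 : ℝ → ℝ := fun t =>
  ∑' n : ℕ, if (2:ℝ) ^ (n + 1) - 2 < t ∧ t < (2:ℝ) ^ (n + 1) - 1 then ((n + 1 : ℕ) : ℝ) else 0

lemma iterLog_two_nonneg (t : ℝ) : 0 ≤ iterLog 2 t := by
  show 0 ≤ (if 1 < iterLog 1 t then Real.log (iterLog 1 t) else 0)
  split_ifs with h
  · exact Real.log_nonneg h.le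
  · exact le_rfl

lemma lam2_nonneg (t : ℝ) : 0 ≤ lam2 t := by
  unfold lam2
  refine tsum_nonneg fun n => ?_
  split_ifs
  · positivity
  · exact le_rfl

lemma two_pow_step {a b : ℕ} (h : a < b) : 2 * (2:ℝ) ^ a ≤ 2 ^ b := by
  have : (2:ℝ) ^ (a + 1) ≤ 2 ^ b := pow_le_pow_right₀ (by norm_num) h
  rw [pow_succ] at this
  linarith

lemma lam2_zero (k : ℕ) : lam2 ((2:ℝ) ^ (k + 1) - 1) = 0 := by
  unfold lam2
  have : ∀ n : ℕ, (if (2:ℝ) ^ (n + 1) - 2 < (2:ℝ) ^ (k + 1) - 1 ∧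
      (2:ℝ) ^ (k + 1) - 1 < (2:ℝ) ^ (n + 1) - 1 then ((n + 1 : ℕ) : ℝ) else 0) = 0 := by
    intro n
    rw [if_neg]
    rintro ⟨h1, h2⟩
    have h3 : (2:ℝ) ^ (k + 1) < 2 ^ (n + 1) := by linarith
    have h4 : k + 1 < n + 1 := (pow_lt_pow_iff_right₀ (by norm_num)).1 h3
    have h5 := two_pow_step h4
    have h6 : (1:ℝ) ≤ 2 ^ (k + 1) := one_le_pow₀ (by norm_num)
    linarith
  simp only [this, tsum_zero]

lemma lam2_mid (k : ℕ) : lam2 ((2:ℝ) ^ (k + 1) - 3 / 2) = ((k + 1 : ℕ) : ℝ) := by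
  unfold lam2
  rw [tsum_eq_single k]
  · rw [if_pos]
    constructor <;> linarith
  · intro n hn
    rw [if_neg]
    rintro ⟨h1, h2⟩
    have h6 : (1:ℝ) ≤ 2 ^ (k + 1) := one_le_pow₀ (by norm_num)
    have h7 : (1:ℝ) ≤ 2 ^ (n + 1) := one_le_pow₀ (by norm_num)
    rcases lt_or_gt_of_ne hn with h | h
    · have h5 := two_pow_step (Nat.succ_lt_succ h)
      simp only [Nat.succ_eq_add_one] at h5
      linarith
    · have h5 := two_pow_step (Nat.succ_lt_succ h)
      simp only [Nat.succ_eq_add_one] at h5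
      linarith

lemma iterLog_two_bounds {t : ℝ} (ht : 3 ≤ t) : 0 < iterLog 2 t ∧ iterLog 2 t ≤ t := by
  have h1 : 1 < Real.log t := by
    rw [Real.lt_log_iff_exp_lt (by linarith)]
    linarith [Real.exp_one_lt_d9]
  have e1 : iterLog 1 t = Real.log t := by
    show (if 1 < t then Real.log t else 0) = _
    rw [if_pos (by linarith)]
  have e2 : iterLog 2 t = Real.log (Real.log t) := by
    show (if 1 < iterLog 1 t then Real.log (iterLog 1 t) else 0) = _
    rw [e1, if_pos h1]
  rw [e2]
  refine ⟨Real.log_pos h1, ?_⟩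
  have := Real.log_le_sub_one_of_pos (show 0 < Real.log t by linarith)
  have := Real.log_le_sub_one_of_pos (show 0 < t by linarith)
  linarith

lemma nat_lt_two_pow_real (k : ℕ) : (k : ℝ) + 2 ≤ 2 ^ (k + 1) := by
  have : k + 2 ≤ 2 ^ (k + 1) := Nat.lt_two_pow_self (n := k + 1)
  exact_mod_cast this

theorem stmt_18 :
    Filter.liminf (fun t : ℝ => ((t * lam2 t / iterLog 2 t : ℝ) : EReal)) Filter.atTop = 0 ∧
    Filter.limsup (fun t : ℝ => ((t * lam2 t / iterLog 2 t : ℝ) : EReal)) Filter.atTop = ⊤ := by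
  constructor
  · apply le_antisymm
    · refine liminf_le_of_frequently_le' ?_
      rw [frequently_atTop]
      intro a
      obtain ⟨k, hk⟩ := exists_nat_ge a
      refine ⟨(2:ℝ) ^ (k + 1) - 1, ?_, ?_⟩
      · have := nat_lt_two_pow_real k
        show a ≤ _
        linarith
      · rw [lam2_zero]
        simp
    · refine le_liminf_of_le (by isBoundedDefault) ?_
      filter_upwards [eventually_ge_atTop (0:ℝ)] with t ht
      exact_mod_cast div_nonneg (mul_nonneg ht (lam2_nonneg t)) (iterLog_two_nonneg t)
  · rw [EReal.eq_top_iff_forall_lt]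
    intro y
    have key : ((y + 1 : ℝ) : EReal) ≤
        Filter.limsup (fun t : ℝ => ((t * lam2 t / iterLog 2 t : ℝ) : EReal)) Filter.atTop := by
      refine le_limsup_of_frequently_le' ?_
      rw [frequently_atTop]
      intro a
      obtain ⟨k, hk⟩ := exists_nat_ge (max (max a y) 3)
      have hk1 : a ≤ k := le_trans (le_trans (le_max_left _ _) (le_max_left _ _)) hk
      have hk2 : y ≤ k := le_trans (le_trans (le_max_right _ _) (le_max_left _ _)) hk
      have hk3 : (3:ℝ) ≤ k := le_trans (le_max_right _ _) hk
      have h2 := nat_lt_two_pow_real k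
      refine ⟨(2:ℝ) ^ (k + 1) - 3 / 2, ?_, ?_⟩
      · show a ≤ _
        linarith
      · rw [lam2_mid]
        have ht : (3:ℝ) ≤ (2:ℝ) ^ (k + 1) - 3 / 2 := by linarith
        obtain ⟨b1, b2⟩ := iterLog_two_bounds ht
        rw [EReal.coe_le_coe_iff, le_div_iff₀ b1]
        push_cast
        have hk0 : (0:ℝ) ≤ (k:ℝ) + 1 := by linarith
        calc (y + 1) * _ ≤ ((k:ℝ) + 1) * iterLog 2 ((2:ℝ) ^ (k + 1) - 3 / 2) :=
              mul_le_mul_of_nonneg_right (by linarith) b1.le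
          _ ≤ ((k:ℝ) + 1) * ((2:ℝ) ^ (k + 1) - 3 / 2) := mul_le_mul_of_nonneg_left b2 hk0
          _ = _ := by ring
    refine lt_of_lt_of_le ?_ key
    exact_mod_cast lt_add_one y
end
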